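/- arXiv:1908.06333 — 2 statements merged into one kernel-verified Lean document; each statement's English description precedes it below -/
import Mathlib

section
/- Let r = r(n) ≥ 3 and m = m(n) with r^{-2} n ≤ m = o(r^{-3} n^{3/2}) as n → ∞. Then |C^{++}_{0,0,0,0}| = ( 1 − O( r^6 / n^3 ) ) · |L_r(n,m)|, where C^{++}_{0,0,0,0} is the set of H in H_r^{++}(n,m) having no clusters of any type (equivalently, the set of linear r-graphs in H_r(n,m) in which every vertex has degree at most M_0*). -/
open Filter Finset

/-- `Hgraphs n r m`: the set of `r`-graphs on vertex set `Fin n` with exactly `m` edges. -/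
def Hgraphs (n r m : ℕ) : Finset (Finset (Finset (Fin n))) :=
  Finset.univ.filter fun H => (∀ e ∈ H, e.card = r) ∧ H.card = m

/-- A hypergraph is linear if any two distinct edges share at most one vertex. -/
def IsLinear {n : ℕ} (H : Finset (Finset (Fin n))) : Prop :=
  ∀ e ∈ H, ∀ f ∈ H, e ≠ f → (e ∩ f).card ≤ 1

instance {n : ℕ} : DecidablePred (IsLinear (n := n)) := fun _ => by
  unfold IsLinear; infer_instance

/-- `Lgraphs n r m`: the set of linear `r`-graphs on `Fin n` with exactly `m` edges. -/
def Lgraphs (n r m : ℕ) : Finset (Finset (Finset (Fin n))) :=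
  (Hgraphs n r m).filter IsLinear

/-- The degree of a vertex: the number of edges containing it. -/
def hdegree {n : ℕ} (H : Finset (Finset (Fin n))) (v : Fin n) : ℕ :=
  (H.filter fun e => v ∈ e).card

/-- `C` is a cluster of `H`: the edge set of a component, with at least two edges, of the
graph on the edges of `H` in which two edges are adjacent iff they are linked (they meet in
exactly two vertices). -/
def IsCluster {n : ℕ} (H C : Finset (Finset (Fin n))) : Prop :=
  C ⊆ H ∧ 2 ≤ C.card ∧
  (∀ e ∈ C, ∀ f ∈ C,
    Relation.ReflTransGen (fun a b => a ∈ C ∧ b ∈ C ∧ (a ∩ b).card = 2) e f) ∧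
  (∀ e ∈ C, ∀ f ∈ H, (e ∩ f).card = 2 → f ∈ C)

/-- Type-1 cluster: three edges spanning `3r-4` vertices, one edge `e` linked to each of
`f, g` through two disjoint `2`-subsets of `e`, with `f` and `g` meeting only inside `e`. -/
def IsType1 {n : ℕ} (r : ℕ) (C : Finset (Finset (Fin n))) : Prop :=
  ∃ e f g : Finset (Fin n), C = {e, f, g} ∧ e ≠ f ∧ e ≠ g ∧ f ≠ g ∧
    (C.sup id).card = 3 * r - 4 ∧
    (e ∩ f).card = 2 ∧ (e ∩ g).card = 2 ∧ Disjoint (e ∩ f) (e ∩ g) ∧ f ∩ g ⊆ e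

/-- Type-2 cluster: as Type-1 but the two `2`-subsets of `e` share exactly one vertex. -/
def IsType2 {n : ℕ} (r : ℕ) (C : Finset (Finset (Fin n))) : Prop :=
  ∃ e f g : Finset (Fin n), C = {e, f, g} ∧ e ≠ f ∧ e ≠ g ∧ f ≠ g ∧
    (C.sup id).card = 3 * r - 4 ∧
    (e ∩ f).card = 2 ∧ (e ∩ g).card = 2 ∧ ((e ∩ f) ∩ (e ∩ g)).card = 1 ∧ f ∩ g ⊆ e

/-- Type-3 cluster: three edges containing a common `2`-subset and pairwise disjoint
outside it. -/
def IsType3 {n : ℕ} (r : ℕ) (C : Finset (Finset (Fin n))) : Prop :=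
  ∃ e f g : Finset (Fin n), C = {e, f, g} ∧ e ≠ f ∧ e ≠ g ∧ f ≠ g ∧
    (C.sup id).card = 3 * r - 4 ∧
    ∃ s : Finset (Fin n), s.card = 2 ∧ e ∩ f = s ∧ e ∩ g = s ∧ f ∩ g = s

/-- Type-4 cluster: exactly two linked edges. -/
def IsType4 {n : ℕ} (C : Finset (Finset (Fin n))) : Prop :=
  ∃ e f : Finset (Fin n), C = {e, f} ∧ e ≠ f ∧ (e ∩ f).card = 2

/-- The number of clusters of `H` satisfying a property `P`. -/
noncomputable def clusterCount {n : ℕ} (H : Finset (Finset (Fin n)))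
    (P : Finset (Finset (Fin n)) → Prop) : ℕ :=
  {C | IsCluster H C ∧ P C}.ncard

noncomputable def M0star (n r m : ℕ) : ℕ :=
  ⌈Real.log ((n : ℝ) / (r : ℝ) ^ 2) + 81 * (r : ℝ) ^ 2 * (m : ℝ) / (n : ℝ)⌉₊

noncomputable def M0 (n r m : ℕ) : ℕ := M0star n r m + 3

noncomputable def M1 (n r m : ℕ) : ℕ :=
  ⌈Real.log ((n : ℝ) / (r : ℝ) ^ 2) + 81 * (r : ℝ) ^ 8 * (m : ℝ) ^ 3 / (2 * (n : ℝ) ^ 4)⌉₊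

noncomputable def M2 (n r m : ℕ) : ℕ :=
  ⌈Real.log ((n : ℝ) / (r : ℝ) ^ 2) + 81 * (r : ℝ) ^ 7 * (m : ℝ) ^ 3 / (2 * (n : ℝ) ^ 4)⌉₊

noncomputable def M3 (n r m : ℕ) : ℕ :=
  ⌈Real.log ((n : ℝ) / (r : ℝ) ^ 2) + 81 * (r : ℝ) ^ 6 * (m : ℝ) ^ 3 / (2 * (n : ℝ) ^ 4)⌉₊

noncomputable def M4 (n r m : ℕ) : ℕ :=
  ⌈Real.log ((n : ℝ) / (r : ℝ) ^ 2) + 81 * (r : ℝ) ^ 4 * (m : ℝ) ^ 2 / (2 * (n : ℝ) ^ 2)⌉₊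

/-- `H_r^+(n,m)` with a prescribed degree bound `d₀` in place of property (g). -/
def HplusAux (n r m d₀ : ℕ) : Set (Finset (Finset (Fin n))) :=
  {H | H ∈ Hgraphs n r m ∧
    (∀ e ∈ H, ∀ f ∈ H, e ≠ f → (e ∩ f).card ≤ 2) ∧
    (∀ C, IsCluster H C → IsType1 r C ∨ IsType2 r C ∨ IsType3 r C ∨ IsType4 C) ∧
    (∀ C D, IsCluster H C → IsCluster H D → C ≠ D →
      ((C.sup id) ∩ (D.sup id)).card ≤ 1) ∧
    (∀ C D E, IsCluster H C → IsCluster H D → IsCluster H E →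
      C ≠ D → C ≠ E → D ≠ E →
      (IsType1 r C ∨ IsType2 r C ∨ IsType3 r C) →
      (IsType1 r D ∨ IsType2 r D ∨ IsType3 r D) →
      (IsType1 r E ∨ IsType2 r E ∨ IsType3 r E) →
      9 * r - 13 ≤ ((C.sup id) ∪ (D.sup id) ∪ (E.sup id)).card) ∧
    (∀ C D E, IsCluster H C → IsCluster H D → IsCluster H E →
      C ≠ D → C ≠ E → D ≠ E → IsType4 C → IsType4 D → IsType4 E →
      6 * r - 8 ≤ ((C.sup id) ∪ (D.sup id) ∪ (E.sup id)).card) ∧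
    clusterCount H (IsType1 r) ≤ M1 n r m ∧
    clusterCount H (IsType2 r) ≤ M2 n r m ∧
    clusterCount H (IsType3 r) ≤ M3 n r m ∧
    clusterCount H IsType4 ≤ M4 n r m ∧
    (∀ v, hdegree H v ≤ d₀)}

/-- `H_r^+(n,m)`: `r`-graphs with `m` edges satisfying properties (a)–(g). -/
noncomputable def Hplus (n r m : ℕ) : Set (Finset (Finset (Fin n))) :=
  HplusAux n r m (M0 n r m)

/-- `H_r^{++}(n,m)`: as `H_r^+(n,m)` but with the stronger degree bound `M₀*`. -/
noncomputable def Hplusplus (n r m : ℕ) : Set (Finset (Finset (Fin n))) :=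
  HplusAux n r m (M0star n r m)

/-- `C^+_{h₁,h₂,h₃,h₄}`: members of `H_r^+(n,m)` with exactly `hᵢ` Type-`i` clusters. -/
noncomputable def Cplus (n r m h₁ h₂ h₃ h₄ : ℕ) : Set (Finset (Finset (Fin n))) :=
  {H ∈ Hplus n r m | clusterCount H (IsType1 r) = h₁ ∧ clusterCount H (IsType2 r) = h₂ ∧
    clusterCount H (IsType3 r) = h₃ ∧ clusterCount H IsType4 = h₄}

/-- `C^{++}_{h₁,h₂,h₃,h₄}`: members of `H_r^{++}(n,m)` with exactly `hᵢ` Type-`i` clusters. -/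
noncomputable def Cplusplus (n r m h₁ h₂ h₃ h₄ : ℕ) : Set (Finset (Finset (Fin n))) :=
  {H ∈ Hplusplus n r m | clusterCount H (IsType1 r) = h₁ ∧ clusterCount H (IsType2 r) = h₂ ∧
    clusterCount H (IsType3 r) = h₃ ∧ clusterCount H IsType4 = h₄}

theorem card_filter_superset_le {n : ℕ} (r : ℕ) (T : Finset (Fin n)) :
    ((powersetCard r univ).filter fun s => T ⊆ s).card
      ≤ (n - T.card).choose (r - T.card) := by
  have hT : (univ \ T : Finset (Fin n)).card = n - T.card := by
    rw [card_sdiff_of_subset (subset_univ T)]; simp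
  rw [← hT, ← card_powersetCard]
  refine card_le_card_of_injOn (fun s => s \ T) ?_ ?_
  · intro s hs
    simp only [coe_filter, mem_powersetCard_univ, Set.mem_ofPred_eq] at hs
    simp only [mem_coe, mem_powersetCard]
    exact ⟨sdiff_subset_sdiff (subset_univ s) subset_rfl, by
      rw [card_sdiff_of_subset hs.2, hs.1]⟩
  · intro s hs t ht hst
    simp only [coe_filter, mem_powersetCard_univ, Set.mem_ofPred_eq] at hs ht
    have hst : s \ T = t \ T := hst
    rw [← sdiff_union_of_subset hs.2, hst, sdiff_union_of_subset ht.2]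

theorem card_filter_two_le_card_inter_le {n : ℕ} (r : ℕ) (f : Finset (Fin n)) :
    ((powersetCard r univ).filter fun s => 2 ≤ (f ∩ s).card).card
      ≤ f.card.choose 2 * (n - 2).choose (r - 2) := by
  have hsub : ((powersetCard r univ).filter fun s => 2 ≤ (f ∩ s).card)
      ⊆ (powersetCard 2 f).biUnion fun T => (powersetCard r univ).filter fun s => T ⊆ s := by
    intro s hs
    rw [mem_filter] at hs
    obtain ⟨T, hT, hTc⟩ := exists_subset_card_eq hs.2
    rw [mem_biUnion]
    exact ⟨T, mem_powersetCard.2 ⟨hT.trans inter_subset_left, hTc⟩,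
      mem_filter.2 ⟨hs.1, hT.trans inter_subset_right⟩⟩
  rw [← card_powersetCard]
  refine (card_le_card hsub).trans (card_biUnion_le_card_mul _ _ _ fun T hT => ?_)
  rw [← (mem_powersetCard.1 hT).2]
  exact card_filter_superset_le r T

/-- The `r`-sets avoiding `v` that meet every edge of `G` in at most one vertex. -/
def freeSets {n : ℕ} (r : ℕ) (v : Fin n) (G : Finset (Finset (Fin n))) :
    Finset (Finset (Fin n)) :=
  (powersetCard r univ).filter fun s => v ∉ s ∧ ∀ f ∈ G, (f ∩ s).card ≤ 1

theorem choose_le_card_freeSets {n r : ℕ} (v : Fin n) (G : Finset (Finset (Fin n)))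
    (hG : ∀ f ∈ G, f.card = r) :
    n.choose r ≤ (freeSets r v G).card
      + ((n - 1).choose (r - 1) + G.card * (r.choose 2 * (n - 2).choose (r - 2))) := by
  have hsub : powersetCard r (univ : Finset (Fin n)) ⊆ freeSets r v G ∪
      (((powersetCard r univ).filter fun s => {v} ⊆ s) ∪
        G.biUnion fun f => (powersetCard r univ).filter fun s => 2 ≤ (f ∩ s).card) := by
    intro s hs
    by_cases hv : v ∈ s
    · simp_all
    by_cases h : ∀ f ∈ G, (f ∩ s).card ≤ 1
    · exact mem_union_left _ (mem_filter.2 ⟨hs, hv, h⟩)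
    · push Not at h
      obtain ⟨f, hf, hfs⟩ := h
      exact mem_union_right _ (mem_union_right _
        (mem_biUnion.2 ⟨f, hf, mem_filter.2 ⟨hs, hfs⟩⟩))
  calc n.choose r = (powersetCard r (univ : Finset (Fin n))).card := by simp
    _ ≤ _ := card_le_card hsub
    _ ≤ _ := card_union_le _ _
    _ ≤ _ := by
      gcongr
      refine (card_union_le _ _).trans (add_le_add ?_ ?_)
      · simpa using card_filter_superset_le r {v}
      · refine card_biUnion_le_card_mul _ _ _ fun f hf => ?_
        rw [← hG f hf]
        exact card_filter_two_le_card_inter_le _ f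

theorem mem_Lgraphs {n r m : ℕ} {H : Finset (Finset (Fin n))} :
    H ∈ Lgraphs n r m ↔ ((∀ e ∈ H, e.card = r) ∧ H.card = m) ∧ IsLinear H := by
  simp [Lgraphs, Hgraphs]

/-- Linear `r`-graphs with `m` edges in which `v` has degree at least `d`. -/
def highDegree (n r m : ℕ) (v : Fin n) (d : ℕ) : Finset (Finset (Finset (Fin n))) :=
  (Lgraphs n r m).filter fun H => d ≤ hdegree H v

theorem insert_erase_mem_highDegree {n r m d : ℕ} (hr : 2 ≤ r) {v : Fin n}
    {H : Finset (Finset (Fin n))} (hH : H ∈ highDegree n r m v (d + 1))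
    {e : Finset (Fin n)} (he : e ∈ H) {s : Finset (Fin n)}
    (hs : s ∈ freeSets r v (H.erase e)) :
    s ∉ H.erase e ∧ insert s (H.erase e) ∈ highDegree n r m v d := by
  rw [highDegree, mem_filter, mem_Lgraphs] at hH ⊢
  obtain ⟨⟨⟨hcard, hm⟩, hlin⟩, hdeg⟩ := hH
  rw [freeSets, mem_filter, mem_powersetCard_univ] at hs
  obtain ⟨hsr, hvs, hfree⟩ := hs
  have hsH : s ∉ H.erase e := fun h => by
    have := hfree s h
    rw [inter_self] at this
    omega
  refine ⟨hsH, ⟨⟨?_, ?_⟩, ?_⟩, ?_⟩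
  · intro f hf
    rcases mem_insert.1 hf with rfl | hf
    · exact hsr
    · exact hcard f (mem_of_mem_erase hf)
  · rw [card_insert_of_notMem hsH, card_erase_add_one he, hm]
  · intro f hf g hg hfg
    rcases mem_insert.1 hf with hf | hf <;> rcases mem_insert.1 hg with hg | hg
    · exact absurd (hf.trans hg.symm) hfg
    · rw [hf, inter_comm]; exact hfree g hg
    · rw [hg]; exact hfree f hf
    · exact hlin f (mem_of_mem_erase hf) g (mem_of_mem_erase hg) hfg
  · unfold hdegree at hdeg ⊢
    rw [filter_insert, if_neg hvs, filter_erase]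
    have := pred_card_le_card_erase (s := H.filter fun e => v ∈ e) (a := e)
    omega

/-- Replacing an edge at `v` by one avoiding `v` relates consecutive degree levels. -/
theorem card_highDegree_succ_mul_le {n r m d F : ℕ} (hr : 2 ≤ r) (v : Fin n)
    (hF : ∀ G : Finset (Finset (Fin n)), (∀ f ∈ G, f.card = r) → G.card ≤ m →
      F ≤ (freeSets r v G).card) :
    (highDegree n r m v (d + 1)).card * ((d + 1) * F)
      ≤ (highDegree n r m v d).card * (m * (n - 1).choose (r - 1)) := by
  let A := (highDegree n r m v (d + 1)).sigma fun H =>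
    (H.filter fun e => v ∈ e).sigma fun e => freeSets r v (H.erase e)
  let B := (highDegree n r m v d).sigma fun H =>
    H ×ˢ ((powersetCard r univ).filter fun s => {v} ⊆ s)
  have hA : (highDegree n r m v (d + 1)).card * ((d + 1) * F) ≤ A.card := by
    rw [card_sigma, ← smul_eq_mul]
    refine card_nsmul_le_sum _ _ _ fun H hH => ?_
    rw [highDegree, mem_filter, mem_Lgraphs] at hH
    rw [card_sigma]
    calc (d + 1) * F ≤ (H.filter fun e => v ∈ e).card * F := Nat.mul_le_mul_right _ hH.2
      _ ≤ _ := by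
        rw [← smul_eq_mul]
        refine card_nsmul_le_sum _ _ _ fun e _ => hF _ ?_ ?_
        · exact fun f hf => hH.1.1.1 f (mem_of_mem_erase hf)
        · exact (card_le_card (erase_subset e H)).trans hH.1.1.2.le
  have hB : B.card ≤ (highDegree n r m v d).card * (m * (n - 1).choose (r - 1)) := by
    rw [card_sigma, ← smul_eq_mul]
    refine sum_le_card_nsmul _ _ _ fun H hH => ?_
    rw [highDegree, mem_filter, mem_Lgraphs] at hH
    rw [card_product, hH.1.1.2]
    gcongr
    simpa using card_filter_superset_le r {v}
  refine hA.trans (le_trans ?_ hB)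
  refine card_le_card_of_injOn
    (fun x => ⟨insert x.2.2 (x.1.erase x.2.1), (x.2.2, x.2.1)⟩) ?_ ?_
  · rintro ⟨H, e, s⟩ hx
    simp only [A, mem_coe, mem_sigma, mem_filter] at hx
    obtain ⟨hH, ⟨he, hv⟩, hs⟩ := hx
    have h := insert_erase_mem_highDegree hr hH he hs
    rw [highDegree, mem_filter, mem_Lgraphs] at hH
    simp only [B, mem_coe, mem_sigma, mem_product, mem_filter, mem_powersetCard_univ,
      singleton_subset_iff]
    exact ⟨h.2, mem_insert_self _ _, hH.1.1.1 e he, hv⟩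
  · rintro ⟨H, e, s⟩ hx ⟨H', e', s'⟩ hx' heq
    simp only [A, mem_coe, mem_sigma, mem_filter] at hx hx'
    simp only [Sigma.mk.injEq, heq_eq_eq, Prod.mk.injEq] at heq
    obtain ⟨hins, rfl, rfl⟩ := heq
    have h := (insert_erase_mem_highDegree hr hx.1 hx.2.1.1 hx.2.2).1
    have h' := (insert_erase_mem_highDegree hr hx'.1 hx'.2.1.1 hx'.2.2).1
    have hE : H.erase e = H'.erase e := by
      rw [← erase_insert h, hins, erase_insert h']
    have : H = H' := by
      rw [← insert_erase hx.2.1.1, hE, insert_erase hx'.2.1.1]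
    subst this
    rfl

theorem card_highDegree_mul_factorial_le {n r m : ℕ} (hr : 2 ≤ r) (v : Fin n)
    {c : ℝ} (hc : 0 ≤ c) {F : ℕ} (hF0 : 0 < F)
    (hF : ∀ G : Finset (Finset (Fin n)), (∀ f ∈ G, f.card = r) → G.card ≤ m →
      F ≤ (freeSets r v G).card)
    (hFc : (m : ℝ) * ((n - 1).choose (r - 1) : ℕ) ≤ c * F) (d : ℕ) :
    ((highDegree n r m v d).card : ℝ) * (d.factorial : ℝ)
      ≤ c ^ d * ((Lgraphs n r m).card : ℝ) := by
  induction d with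
  | zero => simp [highDegree]
  | succ d ih =>
    have hstep : ((highDegree n r m v (d + 1)).card : ℝ) * ((d + 1) * F)
        ≤ (highDegree n r m v d).card * (m * ((n - 1).choose (r - 1) : ℕ)) := by
      exact_mod_cast card_highDegree_succ_mul_le hr v hF
    have hFpos : (0 : ℝ) < F := by exact_mod_cast hF0
    have h1 : ((highDegree n r m v (d + 1)).card : ℝ) * (d + 1)
        ≤ (highDegree n r m v d).card * c := by
      refine le_of_mul_le_mul_right ?_ hFpos
      calc _ = ((highDegree n r m v (d + 1)).card : ℝ) * ((d + 1) * F) := by ring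
        _ ≤ _ := hstep
        _ ≤ (highDegree n r m v d).card * (c * F) := by gcongr
        _ = _ := by ring
    rw [Nat.factorial_succ]
    push_cast
    calc _ = ((highDegree n r m v (d + 1)).card : ℝ) * (d + 1) * d.factorial := by ring
      _ ≤ (highDegree n r m v d).card * c * d.factorial := by gcongr
      _ = c * ((highDegree n r m v d).card * d.factorial) := by ring
      _ ≤ c * (c ^ d * (Lgraphs n r m).card) := by gcongr
      _ = _ := by ring

theorem not_isCluster_of_isLinear {n : ℕ} {H C : Finset (Finset (Fin n))} (hH : IsLinear H) :
    ¬ IsCluster H C := by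
  rintro ⟨hCH, hC2, hconn, -⟩
  obtain ⟨e, he, f, hf, hef⟩ := one_lt_card.1 hC2
  have hpath := hconn e he f hf
  clear hf
  refine hef (Eq.symm ?_)
  clear hef
  induction hpath with
  | refl => rfl
  | tail _ hstep ih =>
    subst ih
    by_contra hne
    have := hH _ (hCH hstep.1) _ (hCH hstep.2.1) (Ne.symm hne)
    have := hstep.2.2
    omega

/-- Two linked edges lie in a cluster. -/
theorem exists_isCluster_of_linked {n : ℕ} {H : Finset (Finset (Fin n))}
    {e f : Finset (Fin n)} (he : e ∈ H) (hf : f ∈ H) (hef : e ≠ f)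
    (hlink : (e ∩ f).card = 2) : ∃ C, IsCluster H C := by
  classical
  let R : Finset (Fin n) → Finset (Fin n) → Prop := fun a b => a ∈ H ∧ b ∈ H ∧ (a ∩ b).card = 2
  let C := H.filter fun g => Relation.ReflTransGen R e g
  have hmem : ∀ g, g ∈ C ↔ g ∈ H ∧ Relation.ReflTransGen R e g := fun g => mem_filter
  have heC : e ∈ C := (hmem e).2 ⟨he, .refl⟩
  have hfC : f ∈ C := (hmem f).2 ⟨hf, .single ⟨he, hf, hlink⟩⟩
  let S : Finset (Fin n) → Finset (Fin n) → Prop := fun a b => a ∈ C ∧ b ∈ C ∧ (a ∩ b).card = 2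
  have : Std.Symm S := ⟨fun a b h => ⟨h.2.1, h.1, by rw [inter_comm]; exact h.2.2⟩⟩
  have hreach : ∀ g, Relation.ReflTransGen R e g → Relation.ReflTransGen S e g := by
    intro g hg
    induction hg with
    | refl => exact .refl
    | @tail a b hab hstep ih =>
      exact ih.tail ⟨(hmem a).2 ⟨hstep.1, hab⟩, (hmem b).2 ⟨hstep.2.1, hab.tail hstep⟩,
        hstep.2.2⟩
  refine ⟨C, filter_subset _ _, one_lt_card.2 ⟨e, heC, f, hfC, hef⟩, ?_, ?_⟩
  · intro a ha b hb
    exact (symm (r := Relation.ReflTransGen S) (hreach a ((hmem a).1 ha).2)).trans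
      (hreach b ((hmem b).1 hb).2)
  · intro a ha g hg hag
    have ha' := (hmem a).1 ha
    exact (hmem g).2 ⟨hg, ha'.2.tail ⟨ha'.1, hg, hag⟩⟩

theorem Cplusplus_zero_eq (n r m : ℕ) :
    Cplusplus n r m 0 0 0 0
      = ((Lgraphs n r m).filter fun H => ∀ v, hdegree H v ≤ M0star n r m) := by
  ext H
  simp only [coe_filter, Set.mem_ofPred_eq, Cplusplus, Hplusplus, HplusAux]
  constructor
  · rintro ⟨⟨hH, htwo, htype, -, -, -, -, -, -, -, hdeg⟩, h1, h2, h3, h4⟩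
    refine ⟨mem_filter.2 ⟨hH, fun e he f hf hef => ?_⟩, hdeg⟩
    by_contra hlt
    have hlink : (e ∩ f).card = 2 := by
      have := htwo e he f hf hef
      omega
    obtain ⟨C, hC⟩ := exists_isCluster_of_linked he hf hef hlink
    have hno : ∀ P, clusterCount H P = 0 → ¬ P C := by
      intro P hP hPC
      rw [clusterCount, Set.ncard_eq_zero] at hP
      exact (Set.eq_empty_iff_forall_notMem.1 hP C) ⟨hC, hPC⟩
    rcases htype C hC with h | h | h | h
    · exact hno _ h1 h
    · exact hno _ h2 h
    · exact hno _ h3 h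
    · exact hno _ h4 h
  · rintro ⟨hL, hdeg⟩
    have hlin : IsLinear H := (mem_filter.1 hL).2
    have hno : ∀ C, ¬ IsCluster H C := fun C => not_isCluster_of_isLinear hlin
    have hcount : ∀ P, clusterCount H P = 0 := by
      intro P
      rw [clusterCount, Set.ncard_eq_zero]
      exact Set.eq_empty_iff_forall_notMem.2 fun C hC => hno C hC.1
    refine ⟨⟨(mem_filter.1 hL).1, fun e he f hf hef => (hlin e he f hf hef).trans (by norm_num),
      fun C hC => absurd hC (hno C), fun C _ hC => absurd hC (hno C),
      fun C _ _ hC => absurd hC (hno C), fun C _ _ hC => absurd hC (hno C), ?_, ?_, ?_, ?_, hdeg⟩,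
      hcount _, hcount _, hcount _, hcount _⟩ <;> simp [hcount]

theorem abs_ncard_Cplusplus_zero_sub_le (n r m : ℕ) :
    |((Cplusplus n r m 0 0 0 0).ncard : ℝ) - ((Lgraphs n r m).card : ℝ)|
      ≤ ∑ v : Fin n, ((highDegree n r m v (M0star n r m + 1)).card : ℝ) := by
  rw [Cplusplus_zero_eq, Set.ncard_coe_finset]
  have hsplit := card_filter_add_card_filter_not (s := Lgraphs n r m)
    (fun H => ∀ v, hdegree H v ≤ M0star n r m)
  have hunion : ((Lgraphs n r m).filter fun H => ¬ ∀ v, hdegree H v ≤ M0star n r m).card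
      ≤ ∑ v : Fin n, (highDegree n r m v (M0star n r m + 1)).card := by
    refine (card_le_card fun H hH => ?_).trans card_biUnion_le
    rw [mem_filter] at hH
    obtain ⟨hL, hdeg⟩ := hH
    push Not at hdeg
    obtain ⟨v, hv⟩ := hdeg
    exact mem_biUnion.2 ⟨v, mem_univ v, mem_filter.2 ⟨hL, hv⟩⟩
  have hsplit' := congrArg (Nat.cast : ℕ → ℝ) hsplit
  have hunion' : (_ : ℝ) ≤ _ := Nat.cast_le.2 hunion
  push_cast at hsplit' hunion'
  rw [abs_le]
  constructor <;> linarith [Nat.cast_nonneg (α := ℝ)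
    ((Lgraphs n r m).filter fun H => ¬ ∀ v, hdegree H v ≤ M0star n r m).card]

theorem mul_choose_pred_eq {n r : ℕ} (hn : 1 ≤ n) (hr : 1 ≤ r) :
    n * (n - 1).choose (r - 1) = r * n.choose r := by
  obtain ⟨n, rfl⟩ := Nat.exists_eq_add_of_le' hn
  obtain ⟨r, rfl⟩ := Nat.exists_eq_add_of_le' hr
  rw [Nat.add_sub_cancel, Nat.add_sub_cancel, Nat.add_one_mul_choose_eq, mul_comm]

/-- At least three quarters of all `r`-sets are free when `r ≤ n / 8` and `m r⁴ ≤ n² / 8`. -/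
theorem three_quarters_choose_le {n r m : ℕ} (hr : 3 ≤ r) (hrn : (r : ℝ) ≤ n / 8)
    (hm : (m : ℝ) * r ^ 4 ≤ n ^ 2 / 8) :
    3 / 4 * (n.choose r : ℝ) ≤ ((n.choose r - ((n - 1).choose (r - 1)
      + m * (r.choose 2 * (n - 2).choose (r - 2))) : ℕ) : ℝ) := by
  have hr3 : (3 : ℝ) ≤ r := by exact_mod_cast hr
  have hn : (24 : ℝ) ≤ n := by linarith
  have hn' : 24 ≤ n := by exact_mod_cast hn
  have h1 : (n : ℝ) * ((n - 1).choose (r - 1) : ℕ) = r * (n.choose r : ℕ) := by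
    exact_mod_cast mul_choose_pred_eq (by omega) (by omega)
  have h2 : ((n : ℝ) - 1) * ((n - 2).choose (r - 2) : ℕ)
      = (r - 1) * ((n - 1).choose (r - 1) : ℕ) := by
    have h := mul_choose_pred_eq (n := n - 1) (r := r - 1) (by omega) (by omega)
    have h' := congrArg (Nat.cast : ℕ → ℝ) h
    rw [Nat.sub_sub, Nat.sub_sub] at h'
    push_cast [Nat.cast_sub (show 1 ≤ n by omega), Nat.cast_sub (show 1 ≤ r by omega)] at h'
    exact h'
  have h3 : (r.choose 2 : ℝ) = r * (r - 1) / 2 := Nat.cast_choose_two ℝ r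
  set N : ℝ := (n.choose r : ℝ)
  set P : ℝ := ((n - 1).choose (r - 1) : ℝ)
  set Q : ℝ := ((n - 2).choose (r - 2) : ℝ)
  have hN : 0 ≤ N := Nat.cast_nonneg _
  have hP0 : 0 ≤ P := Nat.cast_nonneg _
  have hQ0 : 0 ≤ Q := Nat.cast_nonneg _
  have hP : P ≤ N / 8 := by
    refine le_of_mul_le_mul_left ?_ (show (0 : ℝ) < n by linarith)
    rw [h1]
    nlinarith
  have hQ : (n : ℝ) ^ 2 * Q ≤ 2 * (r ^ 2 * N) := by
    have hnn : (n : ℝ) * Q ≤ 2 * (r * P) := by nlinarith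
    calc (n : ℝ) ^ 2 * Q = n * (n * Q) := by ring
      _ ≤ n * (2 * (r * P)) := by gcongr
      _ = 2 * (r * (n * P)) := by ring
      _ = 2 * (r ^ 2 * N) := by rw [h1]; ring
  have hmQ : (m : ℝ) * (r.choose 2 * Q) ≤ N / 8 := by
    refine le_of_mul_le_mul_left ?_ (show (0 : ℝ) < n ^ 2 by positivity)
    calc (n : ℝ) ^ 2 * (m * (r.choose 2 * Q)) = m * r.choose 2 * (n ^ 2 * Q) := by ring
      _ ≤ m * r.choose 2 * (2 * (r ^ 2 * N)) := by gcongr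
      _ = m * (r * (r - 1)) * (r ^ 2 * N) := by rw [h3]; ring
      _ ≤ m * (r * r) * (r ^ 2 * N) := by gcongr; linarith
      _ = m * r ^ 4 * N := by ring
      _ ≤ n ^ 2 / 8 * N := by gcongr
      _ = n ^ 2 * (N / 8) := by ring
  have hsub : N ≤ ((n.choose r - ((n - 1).choose (r - 1)
      + m * (r.choose 2 * (n - 2).choose (r - 2))) : ℕ) : ℝ) + (P + m * (r.choose 2 * Q)) := by
    simp only [N, P, Q]
    exact_mod_cast le_tsub_add
  linarith

/-- The Poisson-type tail `c ^ t / t!` beyond `t ≥ log x + 81 y`. -/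
theorem pow_div_factorial_le {r t : ℕ} (hr : 3 ≤ r) {x y c : ℝ} (hx : 1 ≤ x) (hy : 1 ≤ y)
    (hc : c = 4 * y / (3 * r)) (ht : Real.log x + 81 * y ≤ t) :
    c ^ t / t.factorial ≤ 9 / r ^ 2 * (1 / x) ^ 4 := by
  have hr3 : (3 : ℝ) ≤ r := by exact_mod_cast hr
  have hlog := Real.log_nonneg hx
  have ht81 : 81 * y ≤ t := by linarith
  have htpos : (0 : ℝ) < t := by linarith
  have hc0 : 0 < c := by rw [hc]; positivity
  have hfac : (t : ℝ) ^ t / t.factorial ≤ Real.exp 1 ^ t := by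
    rw [← Real.exp_nat_mul, mul_one]
    exact Real.pow_div_factorial_le_exp _ htpos.le t
  have hbase : c / t * Real.exp 1 ≤ Real.exp (-4) * (3 / r) := by
    have he5 : Real.exp 1 * Real.exp 4 ≤ 182 := by
      have h4 : Real.exp 4 = Real.exp 1 ^ 4 := by rw [← Real.exp_nat_mul]; norm_num
      have h := Real.exp_one_lt_d9.le
      rw [h4, ← pow_succ']
      calc Real.exp 1 ^ 5 ≤ 2.7182818286 ^ 5 := by gcongr
        _ ≤ 182 := by norm_num
    have hct : c / t ≤ 4 / (243 * r) := by
      rw [hc, div_div, div_le_div_iff₀ (by positivity) (by positivity)]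
      nlinarith
    rw [Real.exp_neg]
    calc c / t * Real.exp 1 ≤ 4 / (243 * r) * Real.exp 1 := by gcongr
      _ = 4 / (243 * r) * (Real.exp 1 * Real.exp 4) * (Real.exp 4)⁻¹ := by
        field_simp
      _ ≤ 4 / (243 * r) * 182 * (Real.exp 4)⁻¹ := by gcongr
      _ = (728 / 729) * ((Real.exp 4)⁻¹ * (3 / r)) := by field_simp; norm_num
      _ ≤ 1 * ((Real.exp 4)⁻¹ * (3 / r)) := by gcongr; norm_num
      _ = _ := one_mul _
  have hexp : Real.exp (-4) ^ t ≤ (1 / x) ^ 4 := by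
    have hx' : (1 / x) ^ 4 = Real.exp (4 * -Real.log x) := by
      rw [show (4 : ℝ) * -Real.log x = (4 : ℕ) * -Real.log x by norm_num, Real.exp_nat_mul,
        Real.exp_neg, Real.exp_log (by linarith), one_div]
    rw [hx', ← Real.exp_nat_mul]
    exact Real.exp_le_exp.2 (by linarith)
  have hr3' : (3 / (r : ℝ)) ^ t ≤ 9 / r ^ 2 := by
    have ht2 : 2 ≤ t := by
      have : (2 : ℝ) ≤ t := by linarith
      exact_mod_cast this
    calc (3 / (r : ℝ)) ^ t ≤ (3 / (r : ℝ)) ^ 2 :=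
        pow_le_pow_of_le_one (by positivity) ((div_le_one (by positivity)).2 hr3) ht2
      _ = 9 / r ^ 2 := by rw [div_pow]; norm_num
  calc c ^ t / t.factorial = (c / t) ^ t * ((t : ℝ) ^ t / t.factorial) := by
        rw [div_pow]; field_simp
    _ ≤ (c / t) ^ t * Real.exp 1 ^ t := by gcongr
    _ = (c / t * Real.exp 1) ^ t := (mul_pow _ _ _).symm
    _ ≤ (Real.exp (-4) * (3 / r)) ^ t := by gcongr
    _ = (3 / (r : ℝ)) ^ t * Real.exp (-4) ^ t := by rw [mul_pow, mul_comm]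
    _ ≤ 9 / r ^ 2 * (1 / x) ^ 4 := by gcongr

theorem card_highDegree_M0star_le {n r m : ℕ} (hr : 3 ≤ r) (hrn : (r : ℝ) ≤ n / 8)
    (hrn2 : (r : ℝ) ^ 2 ≤ n) (hm : (m : ℝ) * r ^ 4 ≤ n ^ 2 / 8)
    (hlb : (n : ℝ) / (r : ℝ) ^ 2 ≤ m) (v : Fin n) :
    ((highDegree n r m v (M0star n r m + 1)).card : ℝ)
      ≤ 9 / r ^ 2 * (r ^ 2 / n) ^ 4 * (Lgraphs n r m).card := by
  have hr3 : (3 : ℝ) ≤ r := by exact_mod_cast hr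
  have hn : (24 : ℝ) ≤ n := by linarith
  have hle : r ≤ n := by
    have : (r : ℝ) ≤ n := by linarith
    exact_mod_cast this
  have hNpos : (0 : ℝ) < n.choose r := by exact_mod_cast Nat.choose_pos hle
  have hF := three_quarters_choose_le hr hrn hm
  set F := n.choose r - ((n - 1).choose (r - 1) + m * (r.choose 2 * (n - 2).choose (r - 2)))
  have hF0 : 0 < F := by
    have : (0 : ℝ) < F := by linarith
    exact_mod_cast this
  have hfree : ∀ G : Finset (Finset (Fin n)), (∀ f ∈ G, f.card = r) → G.card ≤ m →
      F ≤ (freeSets r v G).card := by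
    intro G hG hGm
    have h := choose_le_card_freeSets v G hG
    have h' := Nat.mul_le_mul_right (r.choose 2 * (n - 2).choose (r - 2)) hGm
    omega
  let y : ℝ := r ^ 2 * m / n
  let c : ℝ := 4 * y / (3 * r)
  have hFc : (m : ℝ) * ((n - 1).choose (r - 1) : ℕ) ≤ c * F := by
    have h1 : (n : ℝ) * ((n - 1).choose (r - 1) : ℕ) = r * (n.choose r : ℕ) := by
      have : 1 ≤ n := by omega
      exact_mod_cast mul_choose_pred_eq this (by omega)
    calc (m : ℝ) * ((n - 1).choose (r - 1) : ℕ)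
        = m / n * (n * ((n - 1).choose (r - 1) : ℕ)) := by field_simp
      _ = c * (3 / 4 * n.choose r) := by rw [h1]; simp only [c, y]; field_simp
      _ ≤ c * F := by gcongr
  have hmain := card_highDegree_mul_factorial_le (by omega) v (by positivity) hF0 hfree hFc
    (M0star n r m + 1)
  have hy : 1 ≤ y := by
    rw [div_le_iff₀ (by positivity)] at hlb
    rw [le_div_iff₀ (by linarith)]
    linarith
  have hx : 1 ≤ (n : ℝ) / r ^ 2 := by
    rw [le_div_iff₀ (by positivity)]
    linarith
  have ht : Real.log ((n : ℝ) / r ^ 2) + 81 * y ≤ ((M0star n r m + 1 : ℕ) : ℝ) := by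
    have h : _ ≤ (M0star n r m : ℝ) := Nat.le_ceil _
    have hy' : 81 * y = 81 * (r : ℝ) ^ 2 * m / n := by simp only [y]; ring
    push_cast
    linarith
  have htail := pow_div_factorial_le hr hx hy rfl ht
  rw [one_div_div] at htail
  calc ((highDegree n r m v (M0star n r m + 1)).card : ℝ)
      ≤ c ^ (M0star n r m + 1) * (Lgraphs n r m).card / (M0star n r m + 1).factorial := by
        rwa [le_div_iff₀ (by positivity)]
    _ = c ^ (M0star n r m + 1) / (M0star n r m + 1).factorial * (Lgraphs n r m).card := by
        ring
    _ ≤ _ := by gcongr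

/-- **Theorem 4.1**: for `r⁻²n ≤ m = o(r⁻³n^{3/2})`,
`|C^{++}_{0,0,0,0}| = (1 - O(r⁶/n³)) |L_r(n,m)|`. -/
theorem statement10 (r m : ℕ → ℕ) (hr : ∀ n, 3 ≤ r n)
    (hlb : ∀ᶠ n : ℕ in atTop, (n : ℝ) / (r n : ℝ) ^ 2 ≤ (m n : ℝ))
    (hub : (fun n => (m n : ℝ)) =o[atTop]
      (fun n => (n : ℝ) ^ ((3 : ℝ) / 2) / (r n : ℝ) ^ 3)) :
    ∃ C > (0 : ℝ), ∃ n₀ : ℕ, ∀ n ≥ n₀,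
      |((Cplusplus n (r n) (m n) 0 0 0 0).ncard : ℝ) - ((Lgraphs n (r n) (m n)).card : ℝ)|
        ≤ C * ((r n : ℝ) ^ 6 / (n : ℝ) ^ 3) * ((Lgraphs n (r n) (m n)).card : ℝ) := by
  have hub' := hub.bound (show (0 : ℝ) < 1 / 4 by norm_num)
  obtain ⟨n₀, hn₀⟩ := eventually_atTop.1 ((hlb.and hub').and (eventually_gt_atTop 0))
  refine ⟨9, by norm_num, n₀, fun n hn => ?_⟩
  obtain ⟨⟨hlow, hup⟩, hpos⟩ := hn₀ n hn
  have hr3 : (3 : ℝ) ≤ r n := by exact_mod_cast hr n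
  have hn0 : (0 : ℝ) < n := by exact_mod_cast hpos
  obtain ⟨s, hs, hsn⟩ : ∃ s : ℝ, 0 < s ∧ (n : ℝ) = s ^ 2 :=
    ⟨√n, Real.sqrt_pos.2 hn0, (Real.sq_sqrt hn0.le).symm⟩
  have hpow : (n : ℝ) ^ ((3 : ℝ) / 2) = s ^ 3 := by
    rw [hsn, ← Real.rpow_natCast, ← Real.rpow_mul hs.le, ← Real.rpow_natCast]
    norm_num
  rw [hpow, Real.norm_of_nonneg (by positivity), Real.norm_of_nonneg (by positivity)] at hup
  have hmr : (m n : ℝ) * (r n : ℝ) ^ 3 ≤ s ^ 3 / 4 := by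
    rw [← mul_div_assoc, le_div_iff₀ (by positivity)] at hup
    linarith
  have hrs : (r n : ℝ) ≤ s / 4 := by
    have h := hlow
    rw [div_le_iff₀ (by positivity), hsn] at h
    have h' : s ^ 2 * (r n : ℝ) ≤ s ^ 2 * (s / 4) := by
      calc s ^ 2 * (r n : ℝ) ≤ (m n * (r n : ℝ) ^ 2) * r n := by gcongr
        _ = m n * (r n : ℝ) ^ 3 := by ring
        _ ≤ s ^ 3 / 4 := hmr
        _ = _ := by ring
    exact le_of_mul_le_mul_left h' (by positivity)
  have hrn : (r n : ℝ) ≤ n / 8 := by rw [hsn]; nlinarith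
  have hrn2 : (r n : ℝ) ^ 2 ≤ n := by rw [hsn]; gcongr; linarith
  have hm : (m n : ℝ) * (r n : ℝ) ^ 4 ≤ (n : ℝ) ^ 2 / 8 := by
    calc (m n : ℝ) * (r n : ℝ) ^ 4 = m n * (r n : ℝ) ^ 3 * r n := by ring
      _ ≤ s ^ 3 / 4 * (s / 4) := by gcongr
      _ ≤ (n : ℝ) ^ 2 / 8 := by rw [hsn]; nlinarith [pow_pos hs 4]
  refine (abs_ncard_Cplusplus_zero_sub_le n (r n) (m n)).trans ?_
  calc ∑ v : Fin n, ((highDegree n (r n) (m n) v (M0star n (r n) (m n) + 1)).card : ℝ)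
      ≤ ∑ _v : Fin n, 9 / (r n : ℝ) ^ 2 * ((r n : ℝ) ^ 2 / n) ^ 4 *
          (Lgraphs n (r n) (m n)).card :=
        sum_le_sum fun v _ => card_highDegree_M0star_le (hr n) hrn hrn2 hm hlow v
    _ = _ := by
      rw [sum_const, card_univ, Fintype.card_fin, nsmul_eq_mul]
      field_simp
end

section
/- Let r = r(n) ≥ 3 and m = m(n) with r^{-2} n ≤ m = o(r^{-3} n^{3/2}) as n → ∞, and let h_1, h_2, h_3, h_4 be integers with 0 ≤ h_i ≤ M_i for 1 ≤ i ≤ 4. Then, uniformly over all such h_1, h_2, h_3, h_4, |C^{++}_{h_1,h_2,h_3,h_4}| = ( 1 − O( r^6 / n^3 ) ) · |C^+_{h_1,h_2,h_3,h_4}|. -/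
open Filter Finset

/-- The vertex set of a family of edges. -/
abbrev verts {n : ℕ} (C : Finset (Finset (Fin n))) : Finset (Fin n) := C.sup id

/-- `C` is the edge set of a component of the link graph of `H`. -/
def IsComp {n : ℕ} (H C : Finset (Finset (Fin n))) : Prop :=
  C ⊆ H ∧ C.Nonempty ∧
  (∀ e ∈ C, ∀ f ∈ C,
    Relation.ReflTransGen (fun a b => a ∈ C ∧ b ∈ C ∧ (a ∩ b).card = 2) e f) ∧
  (∀ e ∈ C, ∀ f ∈ H, (e ∩ f).card = 2 → f ∈ C)

theorem isCluster_iff_isComp {n : ℕ} {H C : Finset (Finset (Fin n))} :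
    IsCluster H C ↔ IsComp H C ∧ 2 ≤ C.card := by
  unfold IsCluster IsComp
  constructor
  · rintro ⟨a, b, c, d⟩
    exact ⟨⟨a, card_pos.mp (by omega), c, d⟩, b⟩
  · rintro ⟨⟨a, b, c, d⟩, e⟩
    exact ⟨a, e, c, d⟩

theorem IsCluster.isComp {n : ℕ} {H C : Finset (Finset (Fin n))} (h : IsCluster H C) :
    IsComp H C := (isCluster_iff_isComp.mp h).1

theorem mem_verts {n : ℕ} {C : Finset (Finset (Fin n))} {v : Fin n} :
    v ∈ verts C ↔ ∃ e ∈ C, v ∈ e := by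
  simp [verts, Finset.mem_sup]

/-- A component of a set of edges with no links to `Y` stays one after adding `Y`. -/
theorem IsComp.union_left {n : ℕ} {X Y D : Finset (Finset (Fin n))}
    (hXY : ∀ x ∈ X, ∀ y ∈ Y, (x ∩ y).card ≠ 2) (h : IsComp X D) : IsComp (X ∪ Y) D := by
  obtain ⟨a, b, c, d⟩ := h
  refine ⟨a.trans subset_union_left, b, c, fun e he f hf hef => ?_⟩
  rcases mem_union.mp hf with hf | hf
  · exact d e he f hf hef
  · exact absurd hef (hXY e (a he) f hf)

theorem IsComp.of_union_of_mem {n : ℕ} {X Y D : Finset (Finset (Fin n))}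
    (hXY : ∀ x ∈ X, ∀ y ∈ Y, (x ∩ y).card ≠ 2) (h : IsComp (X ∪ Y) D)
    {e : Finset (Fin n)} (he : e ∈ D) (heX : e ∈ X) : IsComp X D := by
  obtain ⟨a, b, c, d⟩ := h
  refine ⟨fun f hf => ?_, b, c, fun e he f hf hef => d e he f (mem_union_left _ hf) hef⟩
  induction c e he f hf with
  | refl => exact heX
  | tail _ hbc ih =>
    rcases mem_union.mp (a hbc.2.1) with h' | h'
    · exact h'
    · exact absurd hbc.2.2 (hXY _ (ih hbc.1) _ h')

theorem isComp_union_iff {n : ℕ} {X Y D : Finset (Finset (Fin n))}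
    (hXY : ∀ x ∈ X, ∀ y ∈ Y, (x ∩ y).card ≠ 2) :
    IsComp (X ∪ Y) D ↔ IsComp X D ∨ IsComp Y D := by
  have hYX : ∀ y ∈ Y, ∀ x ∈ X, (y ∩ x).card ≠ 2 := fun y hy x hx => by
    rw [inter_comm]; exact hXY x hx y hy
  constructor
  · intro h
    obtain ⟨e, he⟩ := h.2.1
    rcases mem_union.mp (h.1 he) with hX | hY
    · exact .inl (h.of_union_of_mem hXY he hX)
    · rw [union_comm] at h
      exact .inr (h.of_union_of_mem hYX he hY)
  · rintro (h | h)
    · exact h.union_left hXY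
    · rw [union_comm]; exact h.union_left hYX

theorem IsComp.self {n : ℕ} {H K : Finset (Finset (Fin n))} (h : IsComp H K) : IsComp K K :=
  ⟨Subset.rfl, h.2.1, h.2.2.1, fun _ _ _ hf _ => hf⟩

theorem IsComp.eq_of_self {n : ℕ} {K D : Finset (Finset (Fin n))} (hK : IsComp K K)
    (hD : IsComp K D) : D = K := by
  refine Subset.antisymm hD.1 fun f hf => ?_
  obtain ⟨e, he⟩ := hD.2.1
  induction hK.2.2.1 e (hD.1 he) f hf with
  | refl => exact he
  | tail _ hbc ih => exact hD.2.2.2 _ (ih hbc.1) _ hbc.2.1 hbc.2.2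

theorem isComp_union_self_iff {n : ℕ} {A K D : Finset (Finset (Fin n))}
    (hAK : ∀ x ∈ A, ∀ y ∈ K, (x ∩ y).card ≠ 2) (hK : IsComp K K) :
    IsComp (A ∪ K) D ↔ IsComp A D ∨ D = K := by
  rw [isComp_union_iff hAK]
  exact or_congr_right ⟨hK.eq_of_self, fun h => h ▸ hK⟩

theorem IsComp.not_linked {n : ℕ} {H K : Finset (Finset (Fin n))} (h : IsComp H K) :
    ∀ x ∈ H \ K, ∀ y ∈ K, (x ∩ y).card ≠ 2 := by
  intro x hx y hy hxy
  rw [inter_comm] at hxy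
  exact (mem_sdiff.mp hx).2 (h.2.2.2 y hy x (mem_sdiff.mp hx).1 hxy)

/-- Every edge lies in a component of the link graph. -/
theorem exists_isComp {n : ℕ} {H : Finset (Finset (Fin n))} {e : Finset (Fin n)} (he : e ∈ H) :
    ∃ C, IsComp H C ∧ e ∈ C := by
  classical
  let R : Finset (Fin n) → Finset (Fin n) → Prop :=
    fun a b => a ∈ H ∧ b ∈ H ∧ (a ∩ b).card = 2
  let C := H.filter fun f => Relation.ReflTransGen R e f
  have heC : e ∈ C := mem_filter.mpr ⟨he, .refl⟩
  have hclosed : ∀ a ∈ C, ∀ b ∈ H, (a ∩ b).card = 2 → b ∈ C := fun a ha b hb hab =>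
    mem_filter.mpr ⟨hb, (mem_filter.mp ha).2.tail ⟨(mem_filter.mp ha).1, hb, hab⟩⟩
  have hpath : ∀ f, Relation.ReflTransGen R e f →
      f ∈ C ∧ Relation.ReflTransGen (fun a b => a ∈ C ∧ b ∈ C ∧ (a ∩ b).card = 2) e f := by
    intro f hf
    induction hf with
    | refl => exact ⟨heC, .refl⟩
    | tail _ hbc ih =>
      have := hclosed _ ih.1 _ hbc.2.1 hbc.2.2
      exact ⟨this, ih.2.tail ⟨ih.1, this, hbc.2.2⟩⟩
  have hsymm : Std.Symm (fun a b : Finset (Fin n) => a ∈ C ∧ b ∈ C ∧ (a ∩ b).card = 2) :=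
    ⟨fun a b h => ⟨h.2.1, h.1, by rw [inter_comm]; exact h.2.2⟩⟩
  refine ⟨C, ⟨filter_subset _ _, ⟨e, heC⟩, fun a ha b hb => ?_, hclosed⟩, heC⟩
  exact (symm_of (Relation.ReflTransGen _) (hpath a (mem_filter.mp ha).2).2).trans
    (hpath b (mem_filter.mp hb).2).2

/-- The image of a family of edges under a permutation of the vertices. -/
def relabel {n : ℕ} (σ : Equiv.Perm (Fin n)) (C : Finset (Finset (Fin n))) :
    Finset (Finset (Fin n)) := C.image fun e => e.image σ

theorem card_image_inter {n : ℕ} (σ : Equiv.Perm (Fin n)) (e f : Finset (Fin n)) :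
    (e.image σ ∩ f.image σ).card = (e ∩ f).card := by
  rw [← image_inter _ _ σ.injective, card_image_of_injective _ σ.injective]

theorem card_relabel {n : ℕ} (σ : Equiv.Perm (Fin n)) (C : Finset (Finset (Fin n))) :
    (relabel σ C).card = C.card :=
  card_image_of_injective _ (image_injective σ.injective)

theorem relabel_swap_relabel {n : ℕ} (v w : Fin n) (C : Finset (Finset (Fin n))) :
    relabel (Equiv.swap v w) (relabel (Equiv.swap v w) C) = C := by
  unfold relabel
  rw [image_image]
  conv_rhs => rw [← image_id (s := C)]
  refine image_congr fun e _ => ?_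
  simp only [Function.comp, image_image]
  conv_rhs => rw [id, ← image_id (s := e)]
  exact image_congr fun x _ => by simp

theorem verts_relabel {n : ℕ} (σ : Equiv.Perm (Fin n)) (C : Finset (Finset (Fin n))) :
    verts (relabel σ C) = (verts C).image σ := by
  ext u
  simp only [mem_verts, relabel, mem_image]
  constructor
  · rintro ⟨_, ⟨e, he, rfl⟩, hu⟩
    obtain ⟨x, hx, rfl⟩ := mem_image.mp hu
    exact ⟨x, ⟨e, he, hx⟩, rfl⟩
  · rintro ⟨x, ⟨e, he, hx⟩, rfl⟩
    exact ⟨_, ⟨e, he, rfl⟩, mem_image_of_mem _ hx⟩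

theorem card_verts_relabel {n : ℕ} (σ : Equiv.Perm (Fin n)) (C : Finset (Finset (Fin n))) :
    (verts (relabel σ C)).card = (verts C).card := by
  rw [verts_relabel, card_image_of_injective _ σ.injective]

theorem IsComp.relabel {n : ℕ} {K : Finset (Finset (Fin n))} (σ : Equiv.Perm (Fin n))
    (hK : IsComp K K) : IsComp (relabel σ K) (relabel σ K) := by
  refine ⟨Subset.rfl, hK.2.1.image _, ?_, fun _ _ _ hf _ => hf⟩
  intro e' he' f' hf'
  obtain ⟨e, he, rfl⟩ := mem_image.mp he'
  obtain ⟨f, hf, rfl⟩ := mem_image.mp hf'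
  refine Relation.ReflTransGen.lift (fun e : Finset (Fin n) => e.image σ) ?_ _ _ (hK.2.2.1 e he f hf)
  rintro a b ⟨ha, hb, hab⟩
  exact ⟨mem_image_of_mem _ ha, mem_image_of_mem _ hb, by rw [card_image_inter, hab]⟩

theorem relabel_triple {n : ℕ} (σ : Equiv.Perm (Fin n)) (e f g : Finset (Fin n)) :
    relabel σ {e, f, g} = {e.image σ, f.image σ, g.image σ} := by
  simp [relabel, image_insert]

theorem image_perm_ne {n : ℕ} (σ : Equiv.Perm (Fin n)) {e f : Finset (Fin n)} (h : e ≠ f) :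
    e.image σ ≠ f.image σ := fun h' => h (image_injective σ.injective h')

theorem IsType1.relabel {n r : ℕ} {C : Finset (Finset (Fin n))} (σ : Equiv.Perm (Fin n))
    (h : IsType1 r C) : IsType1 r (relabel σ C) := by
  obtain ⟨e, f, g, rfl, h1, h2, h3, h4, h5, h6, h7, h8⟩ := h
  refine ⟨e.image σ, f.image σ, g.image σ, relabel_triple σ e f g, image_perm_ne σ h1,
    image_perm_ne σ h2, image_perm_ne σ h3, (card_verts_relabel σ _).trans h4,
    by rw [card_image_inter, h5], by rw [card_image_inter, h6], ?_, ?_⟩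
  · rw [← image_inter _ _ σ.injective, ← image_inter _ _ σ.injective]
    exact (disjoint_image σ.injective).mpr h7
  · rw [← image_inter _ _ σ.injective]
    exact image_subset_image h8

theorem IsType2.relabel {n r : ℕ} {C : Finset (Finset (Fin n))} (σ : Equiv.Perm (Fin n))
    (h : IsType2 r C) : IsType2 r (relabel σ C) := by
  obtain ⟨e, f, g, rfl, h1, h2, h3, h4, h5, h6, h7, h8⟩ := h
  refine ⟨e.image σ, f.image σ, g.image σ, relabel_triple σ e f g, image_perm_ne σ h1,
    image_perm_ne σ h2, image_perm_ne σ h3, (card_verts_relabel σ _).trans h4,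
    by rw [card_image_inter, h5], by rw [card_image_inter, h6], ?_, ?_⟩
  · rw [← image_inter _ _ σ.injective, ← image_inter _ _ σ.injective, card_image_inter, h7]
  · rw [← image_inter _ _ σ.injective]
    exact image_subset_image h8

theorem IsType3.relabel {n r : ℕ} {C : Finset (Finset (Fin n))} (σ : Equiv.Perm (Fin n))
    (h : IsType3 r C) : IsType3 r (relabel σ C) := by
  obtain ⟨e, f, g, rfl, h1, h2, h3, h4, s, h5, h6, h7, h8⟩ := h
  refine ⟨e.image σ, f.image σ, g.image σ, relabel_triple σ e f g, image_perm_ne σ h1,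
    image_perm_ne σ h2, image_perm_ne σ h3, (card_verts_relabel σ _).trans h4,
    s.image σ, by rw [card_image_of_injective _ σ.injective, h5], ?_, ?_, ?_⟩
  · rw [← image_inter _ _ σ.injective, h6]
  · rw [← image_inter _ _ σ.injective, h7]
  · rw [← image_inter _ _ σ.injective, h8]

theorem IsType4.relabel {n : ℕ} {C : Finset (Finset (Fin n))} (σ : Equiv.Perm (Fin n))
    (h : IsType4 C) : IsType4 (relabel σ C) := by
  obtain ⟨e, f, rfl, h1, h2⟩ := h
  exact ⟨e.image σ, f.image σ, by simp [_root_.relabel, image_insert], image_perm_ne σ h1,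
    by rw [card_image_inter, h2]⟩

theorem hdegree_union {n : ℕ} {A B : Finset (Finset (Fin n))} (h : Disjoint A B) (u : Fin n) :
    hdegree (A ∪ B) u = hdegree A u + hdegree B u := by
  unfold hdegree
  rw [filter_union, card_union_of_disjoint (disjoint_filter_filter h)]

theorem hdegree_relabel {n : ℕ} (σ : Equiv.Perm (Fin n)) (C : Finset (Finset (Fin n)))
    (u : Fin n) : hdegree (relabel σ C) (σ u) = hdegree C u := by
  unfold hdegree relabel
  rw [filter_image, card_image_of_injective _ (image_injective σ.injective)]
  congr 1
  ext e
  simp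

theorem hdegree_eq_zero {n : ℕ} {C : Finset (Finset (Fin n))} {u : Fin n} (h : u ∉ verts C) :
    hdegree C u = 0 := by
  unfold hdegree
  rw [card_eq_zero, filter_eq_empty_iff]
  exact fun e he hu => h (mem_verts.mpr ⟨e, he, hu⟩)

theorem hdegree_le_card {n : ℕ} (C : Finset (Finset (Fin n))) (u : Fin n) :
    hdegree C u ≤ C.card := card_filter_le _ _

theorem card_le_three_of_type {n r : ℕ} {C : Finset (Finset (Fin n))}
    (h : IsType1 r C ∨ IsType2 r C ∨ IsType3 r C ∨ IsType4 C) : C.card ≤ 3 := by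
  rcases h with ⟨e, f, g, rfl, -⟩ | ⟨e, f, g, rfl, -⟩ | ⟨e, f, g, rfl, -⟩ | ⟨e, f, rfl, -⟩
  · exact card_le_three
  · exact card_le_three
  · exact card_le_three
  · exact card_le_two.trans (by norm_num)

theorem card_verts_le {n r : ℕ} {C : Finset (Finset (Fin n))} (h : ∀ e ∈ C, e.card = r) :
    (verts C).card ≤ C.card * r := by
  rw [verts, sup_eq_biUnion]
  exact card_biUnion_le_card_mul _ _ _ fun e he => (h e he).le

/-- Transfer the component `K` of `H` from the vertex `v` to the vertex `w`. -/
def moveComp {n : ℕ} (H K : Finset (Finset (Fin n))) (v w : Fin n) :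
    Finset (Finset (Fin n)) := (H \ K) ∪ relabel (Equiv.swap v w) K

/-- The component `K` of the `r`-graph `H` contains `v`, and `w` is a vertex outside all clusters
of `H` and all edges that meet `K`. -/
structure Movable {n : ℕ} (r : ℕ) (H K : Finset (Finset (Fin n))) (v w : Fin n) : Prop where
  uniform : ∀ e ∈ H, e.card = r
  card_inter_le : ∀ e ∈ H, ∀ f ∈ H, e ≠ f → (e ∩ f).card ≤ 2
  comp : IsComp H K
  mem : v ∈ verts K
  notMem_cluster : ∀ C, IsCluster H C → w ∉ verts C
  disjoint : ∀ x ∈ H, w ∈ x → Disjoint x (verts K)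

namespace Movable

variable {n r : ℕ} {H K : Finset (Finset (Fin n))} {v w : Fin n}

theorem notMem (h : Movable r H K v w) : w ∉ verts K := by
  intro hw
  obtain ⟨e, he, hwe⟩ := mem_verts.mp hw
  exact disjoint_left.mp (h.disjoint e (h.comp.1 he) hwe) hwe hw

theorem ne (h : Movable r H K v w) : v ≠ w := fun e => h.notMem (e ▸ h.mem)

theorem verts_relabel_eq (h : Movable r H K v w) :
    verts (relabel (Equiv.swap v w) K) = insert w ((verts K).erase v) := by
  rw [verts_relabel]
  ext u
  simp only [mem_image, mem_insert, mem_erase]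
  constructor
  · rintro ⟨x, hx, rfl⟩
    by_cases hxv : x = v
    · left; simp [hxv]
    · have hxw : x ≠ w := fun e => h.notMem (e ▸ hx)
      rw [Equiv.swap_apply_of_ne_of_ne hxv hxw]
      exact .inr ⟨hxv, hx⟩
  · rintro (rfl | ⟨h1, h2⟩)
    · exact ⟨v, h.mem, by simp⟩
    · exact ⟨u, h2, Equiv.swap_apply_of_ne_of_ne h1 fun e => h.notMem (e ▸ h2)⟩

theorem mem_relabel_verts (h : Movable r H K v w) :
    w ∈ verts (relabel (Equiv.swap v w) K) := by
  rw [h.verts_relabel_eq]; exact mem_insert_self _ _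

theorem notMem_relabel_verts (h : Movable r H K v w) :
    v ∉ verts (relabel (Equiv.swap v w) K) := by
  rw [h.verts_relabel_eq]
  simp [h.ne]

theorem card_inter_le_one (h : Movable r H K v w) {x y : Finset (Fin n)} (hx : x ∈ H \ K)
    (hy : y ∈ relabel (Equiv.swap v w) K) : (x ∩ y).card ≤ 1 := by
  have hy' : y ⊆ insert w ((verts K).erase v) := by
    rw [← h.verts_relabel_eq]; exact fun u hu => mem_verts.mpr ⟨y, hy, hu⟩
  by_cases hwx : w ∈ x
  · have hd := h.disjoint x (mem_sdiff.mp hx).1 hwx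
    have : x ∩ y ⊆ {w} := by
      intro u hu
      rcases mem_insert.mp (hy' (mem_inter.mp hu).2) with rfl | hu'
      · exact mem_singleton_self _
      · exact absurd (mem_of_mem_erase hu') (disjoint_left.mp hd (mem_inter.mp hu).1)
    exact (card_le_card this).trans (card_singleton _).le
  · obtain ⟨y, hyK, rfl⟩ := mem_image.mp hy
    have h1 : x ∩ y.image (Equiv.swap v w) ⊆ x ∩ y := by
      intro u hu
      obtain ⟨hux, huy⟩ := mem_inter.mp hu
      have huw : u ≠ w := fun e => hwx (e ▸ hux)
      have huv : u ≠ v := by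
        rintro rfl
        exact h.notMem_relabel_verts (mem_verts.mpr ⟨_, hy, huy⟩)
      obtain ⟨z, hz, hzu⟩ := mem_image.mp huy
      have : z = u := by
        rw [← Equiv.swap_apply_of_ne_of_ne huv huw, Equiv.apply_eq_iff_eq] at hzu
        exact hzu
      exact mem_inter.mpr ⟨hux, this ▸ hz⟩
    have h2 := h.card_inter_le x (mem_sdiff.mp hx).1 y (h.comp.1 hyK)
      fun e => (mem_sdiff.mp hx).2 (e ▸ hyK)
    have h3 := h.comp.not_linked x hx y hyK
    have := card_le_card h1
    omega

theorem not_linked (h : Movable r H K v w) :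
    ∀ x ∈ H \ K, ∀ y ∈ relabel (Equiv.swap v w) K, (x ∩ y).card ≠ 2 := fun x hx y hy => by
  have := h.card_inter_le_one hx hy
  omega

theorem disjoint_relabel (h : Movable r H K v w) (hr : 3 ≤ r) :
    Disjoint (H \ K) (relabel (Equiv.swap v w) K) := by
  rw [disjoint_left]
  intro x hx hx'
  have h1 := h.card_inter_le_one hx hx'
  rw [inter_self, h.uniform x (mem_sdiff.mp hx).1] at h1
  omega

theorem isComp_iff (h : Movable r H K v w) {D : Finset (Finset (Fin n))} :
    IsComp H D ↔ IsComp (H \ K) D ∨ D = K := by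
  conv_lhs => rw [← sdiff_union_of_subset h.comp.1]
  exact isComp_union_self_iff h.comp.not_linked h.comp.self

theorem isComp_moveComp_iff (h : Movable r H K v w) {D : Finset (Finset (Fin n))} :
    IsComp (moveComp H K v w) D ↔ IsComp (H \ K) D ∨ D = relabel (Equiv.swap v w) K :=
  isComp_union_self_iff h.not_linked (h.comp.self.relabel _)

theorem not_isComp_sdiff (h : Movable r H K v w) : ¬ IsComp (H \ K) K := by
  intro h'
  obtain ⟨e, he⟩ := h.comp.2.1
  exact (mem_sdiff.mp (h'.1 he)).2 he

theorem not_isComp_sdiff_relabel (h : Movable r H K v w) (hr : 3 ≤ r) :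
    ¬ IsComp (H \ K) (relabel (Equiv.swap v w) K) := by
  intro h'
  obtain ⟨e, he⟩ := h'.2.1
  exact disjoint_left.mp (h.disjoint_relabel hr) (h'.1 he) he

theorem moveComp_moveComp (h : Movable r H K v w) (hr : 3 ≤ r) :
    (moveComp H K v w \ relabel (Equiv.swap v w) K) ∪
      relabel (Equiv.swap v w) (relabel (Equiv.swap v w) K) = H := by
  rw [relabel_swap_relabel, moveComp, union_sdiff_right,
    sdiff_eq_self_of_disjoint (h.disjoint_relabel hr), sdiff_union_of_subset h.comp.1]

/-- The component of `H` that corresponds to a component of `moveComp H K v w`. -/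
noncomputable def back (K : Finset (Finset (Fin n))) (v w : Fin n)
    (C : Finset (Finset (Fin n))) : Finset (Finset (Fin n)) :=
  if C = relabel (Equiv.swap v w) K then K else C

theorem back_isCluster (h : Movable r H K v w) {C : Finset (Finset (Fin n))}
    (hC : IsCluster (moveComp H K v w) C) : IsCluster H (back K v w C) := by
  rw [isCluster_iff_isComp, h.isComp_moveComp_iff] at hC
  rw [isCluster_iff_isComp, h.isComp_iff]
  unfold back
  split_ifs with hCK
  · exact ⟨.inr rfl, by rw [← card_relabel (Equiv.swap v w), ← hCK]; exact hC.2⟩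
  · exact ⟨.inl (hC.1.resolve_right hCK), hC.2⟩

theorem back_injOn (h : Movable r H K v w) {C D : Finset (Finset (Fin n))}
    (hC : IsCluster (moveComp H K v w) C) (hD : IsCluster (moveComp H K v w) D)
    (hCD : C ≠ D) : back K v w C ≠ back K v w D := by
  have hC := h.isComp_moveComp_iff.mp hC.isComp
  have hD := h.isComp_moveComp_iff.mp hD.isComp
  unfold back
  split_ifs with h1 h2 h2
  · exact absurd (h1.trans h2.symm) hCD
  · rintro rfl
    exact h.not_isComp_sdiff (hD.resolve_right h2)
  · rintro rfl
    exact h.not_isComp_sdiff (hC.resolve_right h1)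
  · exact hCD

theorem back_invariant {P : Finset (Finset (Fin n)) → Prop}
    (hP : ∀ σ C, P C → P (relabel σ C)) {C : Finset (Finset (Fin n))} :
    P (back K v w C) ↔ P C := by
  unfold back
  split_ifs with hC
  · subst hC
    exact ⟨hP _ _, fun h => relabel_swap_relabel v w K ▸ hP (Equiv.swap v w) _ h⟩
  · rfl

theorem clusterCount_moveComp (h : Movable r H K v w) (hr : 3 ≤ r)
    {P : Finset (Finset (Fin n)) → Prop} (hP : ∀ σ C, P C → P (relabel σ C)) :
    clusterCount (moveComp H K v w) P = clusterCount H P := by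
  unfold clusterCount
  have hinj : Set.InjOn (back K v w) {C | IsCluster (moveComp H K v w) C ∧ P C} := by
    intro C hC D hD hCD
    by_contra hne
    exact h.back_injOn hC.1 hD.1 hne hCD
  rw [← hinj.ncard_image]
  · congr 1
    ext D
    constructor
    · rintro ⟨C, ⟨hC, hPC⟩, rfl⟩
      exact ⟨h.back_isCluster hC, (back_invariant hP).mpr hPC⟩
    · rintro ⟨hD, hPD⟩
      have hD' := isCluster_iff_isComp.mp hD
      rw [h.isComp_iff] at hD'
      by_cases hDK : D = K
      · subst hDK
        have hb : back D v w (relabel (Equiv.swap v w) D) = D := by simp [back]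
        refine ⟨relabel (Equiv.swap v w) D, ⟨isCluster_iff_isComp.mpr
          ⟨h.isComp_moveComp_iff.mpr (.inr rfl), by rw [card_relabel]; exact hD'.2⟩,
          hP _ _ hPD⟩, hb⟩
      · have hDA := hD'.1.resolve_right hDK
        refine ⟨D, ⟨isCluster_iff_isComp.mpr ⟨h.isComp_moveComp_iff.mpr (.inl hDA), hD'.2⟩,
          hPD⟩, if_neg ?_⟩
        rintro rfl
        exact h.not_isComp_sdiff_relabel hr hDA

theorem notMem_of_ne (h : Movable r H K v w) {C : Finset (Finset (Fin n))}
    (hC : IsCluster (moveComp H K v w) C) (hne : C ≠ relabel (Equiv.swap v w) K) :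
    w ∉ verts C := by
  have hb := h.back_isCluster hC
  rw [back, if_neg hne] at hb
  exact h.notMem_cluster C hb

theorem verts_back_subset (h : Movable r H K v w) {C : Finset (Finset (Fin n))}
    (hC : IsCluster (moveComp H K v w) C) :
    verts (back K v w C) ⊆ insert v ((verts C).erase w) := by
  unfold back
  split_ifs with hCK
  · rw [hCK, h.verts_relabel_eq, erase_insert]
    · rw [insert_erase h.mem]
    · exact fun hw => h.notMem (mem_of_mem_erase hw)
  · rw [erase_eq_of_notMem (h.notMem_of_ne hC hCK)]
    exact subset_insert _ _

theorem back_eq_of_notMem (h : Movable r H K v w) {C : Finset (Finset (Fin n))}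
    (hw : w ∉ verts C) : back K v w C = C := by
  unfold back
  rw [if_neg]
  rintro rfl
  exact hw h.mem_relabel_verts

theorem card_verts_back_le (h : Movable r H K v w) {C D E : Finset (Finset (Fin n))}
    (hC : IsCluster (moveComp H K v w) C) (hD : IsCluster (moveComp H K v w) D)
    (hE : IsCluster (moveComp H K v w) E) :
    (verts (back K v w C) ∪ verts (back K v w D) ∪ verts (back K v w E)).card ≤
      (verts C ∪ verts D ∪ verts E).card := by
  by_cases hw : w ∈ verts C ∪ verts D ∪ verts E
  · calc _ ≤ (insert v ((verts C ∪ verts D ∪ verts E).erase w)).card := by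
          refine card_le_card (union_subset (union_subset ?_ ?_) ?_)
          · exact (h.verts_back_subset hC).trans (insert_subset_insert _ (erase_subset_erase _
              (subset_union_left.trans subset_union_left)))
          · exact (h.verts_back_subset hD).trans (insert_subset_insert _ (erase_subset_erase _
              (subset_union_right.trans subset_union_left)))
          · exact (h.verts_back_subset hE).trans (insert_subset_insert _ (erase_subset_erase _
              subset_union_right))
      _ ≤ ((verts C ∪ verts D ∪ verts E).erase w).card + 1 := card_insert_le _ _
      _ = _ := card_erase_add_one hw
  · simp only [mem_union, not_or] at hw
    rw [h.back_eq_of_notMem hw.1.1, h.back_eq_of_notMem hw.1.2, h.back_eq_of_notMem hw.2]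

theorem verts_inter_subset_back (h : Movable r H K v w) {C D : Finset (Finset (Fin n))}
    (hC : IsCluster (moveComp H K v w) C) (hD : IsCluster (moveComp H K v w) D) (hCD : C ≠ D) :
    verts C ∩ verts D ⊆ verts (back K v w C) ∩ verts (back K v w D) := by
  have key : ∀ C : Finset (Finset (Fin n)), ∀ u ∈ verts C, u ≠ w → u ∈ verts (back K v w C) := by
    intro C u hu huw
    unfold back
    split_ifs with hCK
    · rw [hCK, h.verts_relabel_eq] at hu
      exact mem_of_mem_erase ((mem_insert.mp hu).resolve_left huw)
    · exact hu
  intro u hu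
  obtain ⟨huC, huD⟩ := mem_inter.mp hu
  have huw : u ≠ w := by
    rintro rfl
    by_cases hCK : C = relabel (Equiv.swap v u) K
    · exact h.notMem_of_ne hD (fun e => hCD (hCK.trans e.symm)) huD
    · exact h.notMem_of_ne hC hCK huC
  exact mem_inter.mpr ⟨key C u huC huw, key D u huD huw⟩

theorem hdegree_moveComp_le (h : Movable r H K v w) (hr : 3 ≤ r) {d : ℕ}
    (hH : ∀ u, hdegree H u ≤ d + 3) (hw : hdegree H w ≤ d) (hK : K.card ≤ 3) (u : Fin n) :
    hdegree (moveComp H K v w) u ≤ d + 3 := by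
  have hHu : ∀ u, hdegree H u = hdegree (H \ K) u + hdegree K u := fun u => by
    conv_lhs => rw [← sdiff_union_of_subset h.comp.1]
    exact hdegree_union sdiff_disjoint u
  have hmu : hdegree (moveComp H K v w) u
      = hdegree (H \ K) u + hdegree K (Equiv.swap v w u) := by
    rw [moveComp, hdegree_union (h.disjoint_relabel hr),
      ← hdegree_relabel (Equiv.swap v w) K, Equiv.swap_apply_self]
  rw [hmu]
  by_cases huw : u = w
  · subst huw
    have := hdegree_le_card K (Equiv.swap v u u)
    have := hHu u
    omega
  by_cases huv : u = v
  · subst huv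
    rw [Equiv.swap_apply_left, hdegree_eq_zero h.notMem]
    have := hHu u
    have := hH u
    omega
  · rw [Equiv.swap_apply_of_ne_of_ne huv huw, ← hHu u]
    exact hH u

theorem moveComp_mem_HplusAux (h : Movable r H K v w) (hr : 3 ≤ r) {m d : ℕ}
    (hH : H ∈ HplusAux n r m (d + 3)) (hw : hdegree H w ≤ d) (hK : K.card ≤ 3) :
    moveComp H K v w ∈ HplusAux n r m (d + 3) := by
  obtain ⟨h0, ha, hb, hc, hd, he, hf1, hf2, hf3, hf4, hg⟩ := hH
  obtain ⟨-, hu, hm⟩ := mem_filter.mp h0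
  have i1 : ∀ (σ : Equiv.Perm (Fin n)) C, IsType1 r C → IsType1 r (relabel σ C) :=
    fun σ _ h => h.relabel σ
  have i2 : ∀ (σ : Equiv.Perm (Fin n)) C, IsType2 r C → IsType2 r (relabel σ C) :=
    fun σ _ h => h.relabel σ
  have i3 : ∀ (σ : Equiv.Perm (Fin n)) C, IsType3 r C → IsType3 r (relabel σ C) :=
    fun σ _ h => h.relabel σ
  have i4 : ∀ (σ : Equiv.Perm (Fin n)) C, IsType4 C → IsType4 (relabel σ C) :=
    fun σ _ h => h.relabel σ
  have i123 : ∀ {C : Finset (Finset (Fin n))}, IsType1 r C ∨ IsType2 r C ∨ IsType3 r C →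
      IsType1 r (back K v w C) ∨ IsType2 r (back K v w C) ∨ IsType3 r (back K v w C) := by
    intro C hC
    rwa [back_invariant i1, back_invariant i2, back_invariant i3]
  refine ⟨mem_filter.mpr ⟨mem_univ _, ?_, ?_⟩, ?_, ?_, ?_, ?_, ?_, ?_, ?_, ?_, ?_,
    h.hdegree_moveComp_le hr hg hw hK⟩
  · intro e he
    rcases mem_union.mp he with he | he
    · exact hu e (mem_sdiff.mp he).1
    · obtain ⟨f, hf, rfl⟩ := mem_image.mp he
      rw [card_image_of_injective _ (Equiv.injective _)]
      exact hu f (h.comp.1 hf)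
  · rw [moveComp, card_union_of_disjoint (h.disjoint_relabel hr), card_relabel,
      card_sdiff_add_card_eq_card h.comp.1, hm]
  · intro e he f hf hef
    rcases mem_union.mp he with he | he <;> rcases mem_union.mp hf with hf | hf
    · exact ha e (mem_sdiff.mp he).1 f (mem_sdiff.mp hf).1 hef
    · exact (h.card_inter_le_one he hf).trans (by norm_num)
    · rw [inter_comm]
      exact (h.card_inter_le_one hf he).trans (by norm_num)
    · obtain ⟨a, haK, rfl⟩ := mem_image.mp he
      obtain ⟨b, hbK, rfl⟩ := mem_image.mp hf
      rw [card_image_inter]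
      exact ha a (h.comp.1 haK) b (h.comp.1 hbK) fun e => hef (e ▸ rfl)
  · intro C hC
    have := hb _ (h.back_isCluster hC)
    rwa [back_invariant i1, back_invariant i2, back_invariant i3, back_invariant i4] at this
  · intro C D hC hD hCD
    exact (card_le_card (h.verts_inter_subset_back hC hD hCD)).trans
      (hc _ _ (h.back_isCluster hC) (h.back_isCluster hD) (h.back_injOn hC hD hCD))
  · intro C D E hC hD hE hCD hCE hDE tC tD tE
    exact (hd _ _ _ (h.back_isCluster hC) (h.back_isCluster hD) (h.back_isCluster hE)
      (h.back_injOn hC hD hCD) (h.back_injOn hC hE hCE) (h.back_injOn hD hE hDE)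
      (i123 tC) (i123 tD) (i123 tE)).trans (h.card_verts_back_le hC hD hE)
  · intro C D E hC hD hE hCD hCE hDE tC tD tE
    exact (he _ _ _ (h.back_isCluster hC) (h.back_isCluster hD) (h.back_isCluster hE)
      (h.back_injOn hC hD hCD) (h.back_injOn hC hE hCE) (h.back_injOn hD hE hDE)
      ((back_invariant i4).mpr tC) ((back_invariant i4).mpr tD)
      ((back_invariant i4).mpr tE)).trans (h.card_verts_back_le hC hD hE)
  · rwa [h.clusterCount_moveComp hr i1]
  · rwa [h.clusterCount_moveComp hr i2]
  · rwa [h.clusterCount_moveComp hr i3]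
  · rwa [h.clusterCount_moveComp hr i4]

theorem moveComp_mem_Cplus (h : Movable r H K v w) (hr : 3 ≤ r) {m h₁ h₂ h₃ h₄ : ℕ}
    (hH : H ∈ Cplus n r m h₁ h₂ h₃ h₄) (hw : hdegree H w ≤ M0star n r m) (hK : K.card ≤ 3) :
    moveComp H K v w ∈ Cplus n r m h₁ h₂ h₃ h₄ := by
  obtain ⟨h0, c1, c2, c3, c4⟩ := hH
  refine ⟨h.moveComp_mem_HplusAux hr h0 hw hK, ?_, ?_, ?_, ?_⟩
  · rw [h.clusterCount_moveComp hr fun σ _ h => h.relabel σ, c1]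
  · rw [h.clusterCount_moveComp hr fun σ _ h => h.relabel σ, c2]
  · rw [h.clusterCount_moveComp hr fun σ _ h => h.relabel σ, c3]
  · rw [h.clusterCount_moveComp hr fun σ _ h => h.relabel σ, c4]

end Movable

section Counting

open scoped Classical in
/-- The components of the link graph of `H` whose number of edges satisfies `P`. -/
noncomputable def comps {n : ℕ} (P : ℕ → Prop) (H : Finset (Finset (Fin n))) :
    Finset (Finset (Finset (Fin n))) :=
  univ.filter fun C => IsComp H C ∧ P C.card

/-- The members of `comps P H` that contain the vertex `v`. -/
noncomputable def compsAt {n : ℕ} (P : ℕ → Prop) (v : Fin n) (H : Finset (Finset (Fin n))) :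
    Finset (Finset (Finset (Fin n))) :=
  (comps P H).filter fun C => v ∈ verts C

open scoped Classical in
/-- The vertices of degree at most `d` to which the component `K` may be transferred. -/
noncomputable def goodVerts {n : ℕ} (d : ℕ) (H K : Finset (Finset (Fin n))) : Finset (Fin n) :=
  univ.filter fun w => hdegree H w ≤ d ∧ (∀ C, IsCluster H C → w ∉ verts C) ∧
    ∀ x ∈ H, w ∈ x → Disjoint x (verts K)

theorem mem_comps {n : ℕ} {P : ℕ → Prop} {H C : Finset (Finset (Fin n))} :
    C ∈ comps P H ↔ IsComp H C ∧ P C.card := by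
  simp [comps]

theorem mem_compsAt {n : ℕ} {P : ℕ → Prop} {v : Fin n} {H C : Finset (Finset (Fin n))} :
    C ∈ compsAt P v H ↔ (IsComp H C ∧ P C.card) ∧ v ∈ verts C := by
  simp [compsAt, mem_comps]

theorem compsAt_moveComp {n r : ℕ} {H K : Finset (Finset (Fin n))} {v w : Fin n}
    (h : Movable r H K v w) (P : ℕ → Prop) :
    compsAt P v (moveComp H K v w) = (compsAt P v H).erase K := by
  ext C
  rw [mem_erase, mem_compsAt, mem_compsAt, h.isComp_iff, h.isComp_moveComp_iff]
  constructor
  · rintro ⟨⟨hC | rfl, hP⟩, hv⟩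
    · exact ⟨fun e => h.not_isComp_sdiff (e ▸ hC), ⟨.inl hC, hP⟩, hv⟩
    · exact absurd hv h.notMem_relabel_verts
  · rintro ⟨hne, ⟨hC | hC, hP⟩, hv⟩
    · exact ⟨⟨.inl hC, hP⟩, hv⟩
    · exact absurd hC hne

theorem card_le_three_of_isComp {n r m d : ℕ} {H K : Finset (Finset (Fin n))}
    (hH : H ∈ HplusAux n r m d) (hK : IsComp H K) : K.card ≤ 3 := by
  by_cases h2 : 2 ≤ K.card
  · exact card_le_three_of_type (hH.2.2.1 K (isCluster_iff_isComp.mpr ⟨hK, h2⟩))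
  · omega

theorem card_verts_le_of_isComp {n r m d : ℕ} {H K : Finset (Finset (Fin n))}
    (hH : H ∈ HplusAux n r m d) (hK : IsComp H K) : (verts K).card ≤ 3 * r :=
  (card_verts_le fun e he => (mem_filter.mp hH.1).2.1 e (hK.1 he)).trans
    (Nat.mul_le_mul_right _ (card_le_three_of_isComp hH hK))

/-- Double counting of the transfers of a component away from `v`. -/
theorem transfer_double_count {n r m h₁ h₂ h₃ h₄ : ℕ} (hr : 3 ≤ r) (P : ℕ → Prop) (v : Fin n)
    {S : Finset (Finset (Finset (Fin n)))} (hS : ∀ H, H ∈ S ↔ H ∈ Cplus n r m h₁ h₂ h₃ h₄)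
    {G B : ℕ} (hG : ∀ H ∈ S, ∀ K, IsComp H K → G ≤ (goodVerts (M0star n r m) H K).card)
    (hB : ∀ H ∈ S, ∑ C ∈ comps P H, (verts C).card ≤ B) (j : ℕ) :
    (S.filter fun H => (compsAt P v H).card = j + 1).card * ((j + 1) * G) ≤
      (S.filter fun H => (compsAt P v H).card = j).card * B := by
  let T := (S.filter fun H => (compsAt P v H).card = j + 1).sigma fun H =>
    (compsAt P v H).sigma fun K => goodVerts (M0star n r m) H K
  let T' := (S.filter fun H => (compsAt P v H).card = j).sigma fun H =>
    (comps P H).sigma fun K => verts K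
  have hT : (S.filter fun H => (compsAt P v H).card = j + 1).card * ((j + 1) * G) ≤ T.card := by
    simp only [T, card_sigma]
    rw [← smul_eq_mul]
    refine card_nsmul_le_sum _ _ _ fun H hH => ?_
    obtain ⟨hHS, hHj⟩ := mem_filter.mp hH
    rw [← hHj, ← smul_eq_mul]
    exact card_nsmul_le_sum _ _ _ fun K hK => hG H hHS K (mem_compsAt.mp hK).1.1
  have hT' : T'.card ≤ (S.filter fun H => (compsAt P v H).card = j).card * B := by
    simp only [T', card_sigma]
    rw [← smul_eq_mul]
    exact sum_le_card_nsmul _ _ _ fun H hH => hB H (mem_filter.mp hH).1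
  have hmov : ∀ p ∈ T, Movable r p.1 p.2.1 v p.2.2 ∧ p.1 ∈ Cplus n r m h₁ h₂ h₃ h₄ ∧
      (compsAt P v p.1).card = j + 1 ∧ p.2.1 ∈ compsAt P v p.1 ∧
      hdegree p.1 p.2.2 ≤ M0star n r m := by
    rintro ⟨H, K, w⟩ hp
    simp only [T, mem_sigma, mem_filter, hS] at hp
    obtain ⟨⟨hH, hj⟩, hK, hw⟩ := hp
    obtain ⟨⟨hKc, hKP⟩, hvK⟩ := mem_compsAt.mp hK
    simp only [goodVerts, mem_filter, mem_univ, true_and] at hw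
    obtain ⟨hwd, hwc, hwx⟩ := hw
    obtain ⟨h0, ha, -⟩ := hH.1
    exact ⟨⟨(mem_filter.mp h0).2.1, ha, hKc, hvK, hwc, hwx⟩, hH, hj, hK, hwd⟩
  refine hT.trans (le_trans ?_ hT')
  refine card_le_card_of_injOn
    (fun p => ⟨moveComp p.1 p.2.1 v p.2.2, relabel (Equiv.swap v p.2.2) p.2.1, p.2.2⟩) ?_ ?_
  · intro p hp
    obtain ⟨hM, hC, hj, hK, hw⟩ := hmov p hp
    obtain ⟨⟨hKc, hKP⟩, hvK⟩ := mem_compsAt.mp hK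
    simp only [T', mem_coe, mem_sigma, mem_filter, hS, mem_comps]
    refine ⟨⟨hM.moveComp_mem_Cplus hr hC hw (card_le_three_of_isComp hC.1 hKc), ?_⟩,
      ⟨hM.isComp_moveComp_iff.mpr (.inr rfl), by rwa [card_relabel]⟩, hM.mem_relabel_verts⟩
    rw [compsAt_moveComp hM, card_erase_of_mem hK, hj, Nat.add_sub_cancel]
  · intro p hp q hq hpq
    have hp' := (hmov p hp).1.moveComp_moveComp hr
    have hq' := (hmov q hq).1.moveComp_moveComp hr
    obtain ⟨H, K, w⟩ := p
    obtain ⟨H', K', w'⟩ := q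
    simp only [Sigma.mk.injEq, heq_eq_eq] at hpq hp' hq'
    obtain ⟨e1, e2, rfl⟩ := hpq
    have hK : K = K' := by
      rw [← relabel_swap_relabel v w K, e2, relabel_swap_relabel]
    subst hK
    rw [e1, hq'] at hp'
    subst hp'
    rfl

theorem sum_hdegree {n : ℕ} (H : Finset (Finset (Fin n))) :
    ∑ v, hdegree H v = ∑ e ∈ H, e.card := by
  have := sum_card_bipartiteAbove_eq_sum_card_bipartiteBelow
    (s := (univ : Finset (Fin n))) (t := H) (fun v e => v ∈ e)
  simpa [bipartiteAbove, bipartiteBelow, hdegree] using this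

theorem card_high_degree_mul_le {n r m d d' : ℕ} {H : Finset (Finset (Fin n))}
    (hH : H ∈ HplusAux n r m d') :
    (univ.filter fun w => d < hdegree H w).card * d ≤ m * r := by
  obtain ⟨-, hu, hm⟩ := mem_filter.mp hH.1
  calc _ ≤ ∑ w ∈ univ.filter (fun w => d < hdegree H w), hdegree H w := by
        rw [← smul_eq_mul]
        exact card_nsmul_le_sum _ _ _ fun w hw => (mem_filter.mp hw).2.le
    _ ≤ ∑ w, hdegree H w := sum_le_sum_of_subset (filter_subset _ _)
    _ = ∑ e ∈ H, e.card := sum_hdegree H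
    _ = m * r := by rw [sum_congr rfl hu, sum_const, hm, smul_eq_mul]

theorem card_comps_two_le {n r m h₁ h₂ h₃ h₄ : ℕ} {H : Finset (Finset (Fin n))}
    (hH : H ∈ Cplus n r m h₁ h₂ h₃ h₄) : (comps (2 ≤ ·) H).card ≤ h₁ + h₂ + h₃ + h₄ := by
  obtain ⟨h0, c1, c2, c3, c4⟩ := hH
  rw [← Set.ncard_coe_finset]
  have hsub : (comps (2 ≤ ·) H : Set (Finset (Finset (Fin n)))) ⊆
      ({C | IsCluster H C ∧ IsType1 r C} ∪ {C | IsCluster H C ∧ IsType2 r C} ∪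
        {C | IsCluster H C ∧ IsType3 r C}) ∪ {C | IsCluster H C ∧ IsType4 C} := by
    intro C hC
    have hC' := isCluster_iff_isComp.mpr (mem_comps.mp hC)
    rcases h0.2.2.1 C hC' with h | h | h | h
    · exact .inl (.inl (.inl ⟨hC', h⟩))
    · exact .inl (.inl (.inr ⟨hC', h⟩))
    · exact .inl (.inr ⟨hC', h⟩)
    · exact .inr ⟨hC', h⟩
  refine (Set.ncard_le_ncard hsub (Set.toFinite _)).trans ?_
  rw [← c1, ← c2, ← c3, ← c4]
  refine (Set.ncard_union_le _ _).trans (Nat.add_le_add_right ?_ _)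
  refine (Set.ncard_union_le _ _).trans (Nat.add_le_add_right ?_ _)
  exact Set.ncard_union_le _ _

theorem le_card_goodVerts_add {n r m h₁ h₂ h₃ h₄ : ℕ} {H K : Finset (Finset (Fin n))}
    (hH : H ∈ Cplus n r m h₁ h₂ h₃ h₄) (hK : IsComp H K) (d : ℕ) :
    n ≤ (goodVerts d H K).card + (univ.filter fun w => d < hdegree H w).card +
      (h₁ + h₂ + h₃ + h₄) * (3 * r) + 3 * r * (M0 n r m * r) := by
  classical
  let B₁ := (comps (2 ≤ ·) H).biUnion verts
  let B₂ := (verts K).biUnion fun u => (H.filter (u ∈ ·)).biUnion id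
  have h1 : B₁.card ≤ (h₁ + h₂ + h₃ + h₄) * (3 * r) :=
    (card_biUnion_le_card_mul _ _ _ fun C hC =>
      card_verts_le_of_isComp hH.1 (mem_comps.mp hC).1).trans
      (Nat.mul_le_mul_right _ (card_comps_two_le hH))
  have h2 : B₂.card ≤ 3 * r * (M0 n r m * r) := by
    refine (card_biUnion_le_card_mul _ _ (M0 n r m * r) fun u _ => ?_).trans
      (Nat.mul_le_mul_right _ (card_verts_le_of_isComp hH.1 hK))
    refine (card_biUnion_le_card_mul _ _ r fun e he => ?_).trans (Nat.mul_le_mul_right _ ?_)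
    · exact ((mem_filter.mp hH.1.1).2.1 e (mem_filter.mp he).1).le
    · exact hH.1.2.2.2.2.2.2.2.2.2.2 u
  have hcover : (univ : Finset (Fin n)) ⊆
      goodVerts d H K ∪ (univ.filter fun w => d < hdegree H w) ∪ B₁ ∪ B₂ := by
    intro w _
    by_contra hw
    simp only [mem_union, not_or] at hw
    obtain ⟨⟨⟨hg, hd⟩, hb1⟩, hb2⟩ := hw
    refine hg (mem_filter.mpr ⟨mem_univ _, ?_, ?_, ?_⟩)
    · by_contra hdw
      exact hd (mem_filter.mpr ⟨mem_univ _, by omega⟩)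
    · intro C hC hwC
      exact hb1 (mem_biUnion.mpr ⟨C, mem_comps.mpr (isCluster_iff_isComp.mp hC), hwC⟩)
    · intro x hx hwx
      rw [disjoint_left]
      intro u hux huK
      exact hb2 (mem_biUnion.mpr ⟨u, huK, mem_biUnion.mpr ⟨x, mem_filter.mpr ⟨hx, hux⟩, hwx⟩⟩)
  have h3 := card_le_card hcover
  rw [card_univ, Fintype.card_fin] at h3
  have h4 := card_union_le (goodVerts d H K ∪ (univ.filter fun w => d < hdegree H w) ∪ B₁) B₂
  have h5 := card_union_le (goodVerts d H K ∪ (univ.filter fun w => d < hdegree H w)) B₁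
  have h6 := card_union_le (goodVerts d H K) (univ.filter fun w => d < hdegree H w)
  omega

theorem sum_comps_two_le {n r m h₁ h₂ h₃ h₄ : ℕ} {H : Finset (Finset (Fin n))}
    (hH : H ∈ Cplus n r m h₁ h₂ h₃ h₄) :
    ∑ C ∈ comps (2 ≤ ·) H, (verts C).card ≤ (h₁ + h₂ + h₃ + h₄) * (3 * r) := by
  refine (sum_le_card_nsmul _ _ (3 * r) fun C hC =>
    card_verts_le_of_isComp hH.1 (mem_comps.mp hC).1).trans ?_
  rw [smul_eq_mul]
  exact Nat.mul_le_mul_right _ (card_comps_two_le hH)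

theorem sum_comps_one_le {n r m d : ℕ} {H : Finset (Finset (Fin n))}
    (hH : H ∈ HplusAux n r m d) :
    ∑ C ∈ comps (· = 1) H, (verts C).card ≤ m * r := by
  obtain ⟨-, hu, hm⟩ := mem_filter.mp hH.1
  have hsub : comps (· = 1) H ⊆ H.image singleton := by
    intro C hC
    obtain ⟨hC1, hC2⟩ := mem_comps.mp hC
    obtain ⟨e, rfl⟩ := card_eq_one.mp hC2
    exact mem_image_of_mem _ (hC1.1 (mem_singleton_self e))
  refine (sum_le_card_nsmul _ _ r fun C hC => ?_).trans ?_
  · obtain ⟨hC1, hC2⟩ := mem_comps.mp hC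
    have := card_verts_le fun e he => hu e (hC1.1 he)
    rwa [hC2, one_mul] at this
  · rw [smul_eq_mul, ← hm]
    exact Nat.mul_le_mul_right _ ((card_le_card hsub).trans card_image_le)

/-- The degree of `v` in terms of the number of components containing it. -/
theorem hdegree_le_compsAt {n r m d : ℕ} {H : Finset (Finset (Fin n))}
    (hH : H ∈ HplusAux n r m d) (v : Fin n) :
    hdegree H v ≤ (compsAt (· = 1) v H).card + 3 * (compsAt (2 ≤ ·) v H).card := by
  have hsub : (H.filter fun e => v ∈ e) ⊆
      (compsAt (· = 1) v H).biUnion id ∪ (compsAt (2 ≤ ·) v H).biUnion id := by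
    intro e he
    obtain ⟨heH, hve⟩ := mem_filter.mp he
    obtain ⟨C, hC, heC⟩ := exists_isComp heH
    have hvC : v ∈ verts C := mem_verts.mpr ⟨e, heC, hve⟩
    have hpos := card_pos.mpr hC.2.1
    by_cases h1 : C.card = 1
    · exact mem_union_left _ (mem_biUnion.mpr ⟨C, mem_compsAt.mpr ⟨⟨hC, h1⟩, hvC⟩, heC⟩)
    · exact mem_union_right _
        (mem_biUnion.mpr ⟨C, mem_compsAt.mpr ⟨⟨hC, by omega⟩, hvC⟩, heC⟩)
  have h1 := card_biUnion_le_card_mul (compsAt (· = 1) v H) id 1 fun C hC =>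
    (mem_compsAt.mp hC).1.2.le
  have h2 := card_biUnion_le_card_mul (compsAt (2 ≤ ·) v H) id 3 fun C hC =>
    card_le_three_of_isComp hH (mem_compsAt.mp hC).1.1
  have h3 := card_le_card hsub
  have h4 := card_union_le ((compsAt (· = 1) v H).biUnion id) ((compsAt (2 ≤ ·) v H).biUnion id)
  unfold hdegree
  omega

/-- A Chernoff-type tail bound from bounds on the ratios of consecutive level sets. -/
theorem card_filter_le_exp {α : Type*} (S : Finset α) (k : α → ℕ) {lam t : ℝ} (K : ℝ)
    (hlam : 0 ≤ lam) (ht : 0 ≤ t)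
    (hstep : ∀ j : ℕ, ((S.filter fun x => k x = j + 1).card : ℝ) * (j + 1) ≤
      (S.filter fun x => k x = j).card * lam) :
    ((S.filter fun x => K ≤ k x).card : ℝ) ≤ Real.exp (lam * Real.exp t - t * K) * S.card := by
  have hlevel : ∀ j : ℕ, ((S.filter fun x => k x = j).card : ℝ) ≤
      lam ^ j / j.factorial * S.card := by
    intro j
    induction j with
    | zero => simpa using card_filter_le _ _
    | succ j ih =>
      have hj : (0 : ℝ) < (j : ℝ) + 1 := by positivity
      have h1 := (hstep j).trans (mul_le_mul_of_nonneg_right ih hlam)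
      rw [← le_div_iff₀ hj] at h1
      refine h1.trans_eq ?_
      rw [Nat.factorial_succ]
      push_cast
      field_simp
      ring
  let N := S.sup k + 1
  have hN : ∀ x ∈ S, k x ∈ range N := fun x hx =>
    mem_range.mpr (Nat.lt_succ_of_le (le_sup (f := k) hx))
  calc ((S.filter fun x => K ≤ k x).card : ℝ)
      = ∑ x ∈ S.filter (fun x => K ≤ k x), (1 : ℝ) := by simp
    _ ≤ ∑ x ∈ S.filter (fun x => K ≤ k x), Real.exp (t * (k x - K)) := by
        refine sum_le_sum fun x hx => Real.one_le_exp ?_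
        exact mul_nonneg ht (sub_nonneg.mpr (mem_filter.mp hx).2)
    _ ≤ ∑ x ∈ S, Real.exp (t * (k x - K)) :=
        sum_le_sum_of_subset_of_nonneg (filter_subset _ _) fun _ _ _ => (Real.exp_pos _).le
    _ = ∑ j ∈ range N, ∑ x ∈ S.filter (fun x => k x = j), Real.exp (t * (k x - K)) :=
        (sum_fiberwise_of_maps_to hN _).symm
    _ = ∑ j ∈ range N, ((S.filter fun x => k x = j).card : ℝ) * Real.exp (t * (j - K)) := by
        refine sum_congr rfl fun j _ => ?_
        rw [← nsmul_eq_mul, ← sum_const]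
        exact sum_congr rfl fun x hx => by rw [(mem_filter.mp hx).2]
    _ ≤ ∑ j ∈ range N, lam ^ j / j.factorial * S.card * Real.exp (t * (j - K)) :=
        sum_le_sum fun j _ => mul_le_mul_of_nonneg_right (hlevel j) (Real.exp_pos _).le
    _ = (∑ j ∈ range N, (lam * Real.exp t) ^ j / j.factorial) *
          (Real.exp (-(t * K)) * S.card) := by
        rw [sum_mul]
        refine sum_congr rfl fun j _ => ?_
        rw [mul_pow, ← Real.exp_nat_mul, mul_sub, sub_eq_add_neg, Real.exp_add, mul_comm t]
        ring
    _ ≤ Real.exp (lam * Real.exp t) * (Real.exp (-(t * K)) * S.card) :=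
        mul_le_mul_of_nonneg_right
          (Real.sum_le_exp_of_nonneg (mul_nonneg hlam (Real.exp_pos _).le) _) (by positivity)
    _ = _ := by rw [sub_eq_add_neg, Real.exp_add, mul_assoc]

end Counting

theorem M0star_le_M0 (n r m : ℕ) : M0star n r m ≤ M0 n r m := Nat.le_add_right _ _

theorem Cplusplus_subset_Cplus (n r m h₁ h₂ h₃ h₄ : ℕ) :
    Cplusplus n r m h₁ h₂ h₃ h₄ ⊆ Cplus n r m h₁ h₂ h₃ h₄ := by
  rintro H ⟨⟨h0, ha, hb, hc, hd, he, hf1, hf2, hf3, hf4, hg⟩, h⟩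
  exact ⟨⟨h0, ha, hb, hc, hd, he, hf1, hf2, hf3, hf4,
    fun v => (hg v).trans (M0star_le_M0 n r m)⟩, h⟩

theorem exists_lt_hdegree {n r m h₁ h₂ h₃ h₄ : ℕ} {H : Finset (Finset (Fin n))}
    (hH : H ∈ Cplus n r m h₁ h₂ h₃ h₄) (hH' : H ∉ Cplusplus n r m h₁ h₂ h₃ h₄) :
    ∃ v, M0star n r m < hdegree H v := by
  by_contra! hg
  obtain ⟨⟨h0, ha, hb, hc, hd, he, hf1, hf2, hf3, hf4, -⟩, h⟩ := hH
  exact hH' ⟨⟨h0, ha, hb, hc, hd, he, hf1, hf2, hf3, hf4, hg⟩, h⟩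

theorem le_M0star (n r m : ℕ) :
    Real.log ((n : ℝ) / (r : ℝ) ^ 2) + 81 * (r : ℝ) ^ 2 * (m : ℝ) / (n : ℝ) ≤ M0star n r m :=
  Nat.le_ceil _

/-- At least half of all vertices can receive a given component. -/
theorem half_le_card_goodVerts {n r m h₁ h₂ h₃ h₄ : ℕ} {H K : Finset (Finset (Fin n))}
    (hr : 3 ≤ r) (hn : 0 < n) (hm : 0 < m) (hL : 0 ≤ Real.log ((n : ℝ) / (r : ℝ) ^ 2))
    (hbad : 3 * (r : ℝ) * ((h₁ + h₂ + h₃ + h₄ : ℕ) : ℝ) + 3 * (r : ℝ) ^ 2 * M0 n r m ≤ n / 4)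
    (hH : H ∈ Cplus n r m h₁ h₂ h₃ h₄) (hK : IsComp H K) :
    (n : ℝ) / 2 ≤ (goodVerts (M0star n r m) H K).card := by
  have h1 := le_card_goodVerts_add hH hK (M0star n r m)
  have h2 := card_high_degree_mul_le (d := M0star n r m) hH.1
  set b := (univ.filter fun w => M0star n r m < hdegree H w).card
  have hn' : (0 : ℝ) < n := Nat.cast_pos.mpr hn
  have hm' : (0 : ℝ) < m := Nat.cast_pos.mpr hm
  have hr' : (3 : ℝ) ≤ r := by exact_mod_cast hr
  have h3 : 81 * (r : ℝ) ^ 2 * (m : ℝ) / (n : ℝ) ≤ M0star n r m := by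
    linarith [le_M0star n r m]
  have h4 : (b : ℝ) * (81 * (r : ℝ) ^ 2 * (m : ℝ) / (n : ℝ)) ≤ m * r :=
    (mul_le_mul_of_nonneg_left h3 (Nat.cast_nonneg _)).trans (by exact_mod_cast h2)
  have h5 : (b : ℝ) * (81 * r) ≤ n := by
    rw [← mul_div_assoc, div_le_iff₀ hn'] at h4
    have hmr : (0 : ℝ) < m * r := by positivity
    refine le_of_mul_le_mul_left ?_ hmr
    linarith
  have h6 : (b : ℝ) ≤ n / 4 := by
    have hb : (0 : ℝ) ≤ b := Nat.cast_nonneg _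
    nlinarith
  have h7 : (n : ℝ) ≤ (goodVerts (M0star n r m) H K).card + b +
      ((h₁ + h₂ + h₃ + h₄ : ℕ) : ℝ) * (3 * r) + 3 * r * (M0 n r m * r) := by
    exact_mod_cast h1
  linarith

theorem ncard_diff_le {n r m h₁ h₂ h₃ h₄ : ℕ}
    (hr : 3 ≤ r) (hn : 0 < n) (hm : 0 < m) (hL : 24 ≤ Real.log ((n : ℝ) / (r : ℝ) ^ 2))
    (hbad : 3 * (r : ℝ) * ((h₁ + h₂ + h₃ + h₄ : ℕ) : ℝ) + 3 * (r : ℝ) ^ 2 * M0 n r m ≤ n / 4)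
    (hclu : 6 * Real.exp 48 * (r : ℝ) ^ 2 * ((h₁ + h₂ + h₃ + h₄ : ℕ) : ℝ) / n ≤ 1) :
    |((Cplusplus n r m h₁ h₂ h₃ h₄).ncard : ℝ) - ((Cplus n r m h₁ h₂ h₃ h₄).ncard : ℝ)| ≤
      4 * ((r : ℝ) ^ 6 / (n : ℝ) ^ 3) * ((Cplus n r m h₁ h₂ h₃ h₄).ncard : ℝ) := by
  classical
  set h := h₁ + h₂ + h₃ + h₄ with hh
  have hn' : (0 : ℝ) < n := Nat.cast_pos.mpr hn
  have hm' : (0 : ℝ) < m := Nat.cast_pos.mpr hm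
  have hr' : (3 : ℝ) ≤ r := by exact_mod_cast hr
  have hr0 : (0 : ℝ) < r := by linarith
  let S : Finset (Finset (Finset (Fin n))) := (Set.toFinite (Cplus n r m h₁ h₂ h₃ h₄)).toFinset
  have hS : ∀ H, H ∈ S ↔ H ∈ Cplus n r m h₁ h₂ h₃ h₄ := fun H => Set.Finite.mem_toFinset _
  have hScard : (Cplus n r m h₁ h₂ h₃ h₄).ncard = S.card := Set.ncard_eq_toFinset_card _ _
  have htail : ∀ (P : ℕ → Prop) (v : Fin n) (B : ℕ),
      (∀ H ∈ S, ∑ C ∈ comps P H, (verts C).card ≤ B) → ∀ t K : ℝ, 0 ≤ t →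
      ((S.filter fun H => K ≤ ((compsAt P v H).card : ℝ)).card : ℝ) ≤
        Real.exp (2 * B / n * Real.exp t - t * K) * S.card := by
    intro P v B hB t K ht
    refine card_filter_le_exp S (fun H => (compsAt P v H).card) K (by positivity) ht fun j => ?_
    have key := transfer_double_count hr P v hS (G := ⌈(n : ℝ) / 2⌉₊) (B := B)
      (fun H hH K hK => Nat.ceil_le.mpr (half_le_card_goodVerts hr hn hm (by linarith) hbad
        ((hS H).mp hH) hK)) hB j
    have key' : ((S.filter fun H => (compsAt P v H).card = j + 1).card : ℝ) *
        ((j + 1) * (⌈(n : ℝ) / 2⌉₊ : ℝ)) ≤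
        (S.filter fun H => (compsAt P v H).card = j).card * B := by exact_mod_cast key
    have hG : (n : ℝ) / 2 ≤ (⌈(n : ℝ) / 2⌉₊ : ℝ) := Nat.le_ceil _
    have h1 : ((S.filter fun H => (compsAt P v H).card = j + 1).card : ℝ) *
        ((j + 1) * ((n : ℝ) / 2)) ≤ (S.filter fun H => (compsAt P v H).card = j).card * B :=
      le_trans (by gcongr) key'
    rw [← mul_div_assoc, le_div_iff₀ hn']
    linarith
  have hlogr : 1 ≤ Real.log r := by
    rw [Real.le_log_iff_exp_le hr0]
    linarith [Real.exp_one_lt_d9]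
  set L := Real.log ((n : ℝ) / (r : ℝ) ^ 2) with hLdef
  have hexp : Real.exp (-(4 * L + 2 * Real.log r)) = (r : ℝ) ^ 6 / (n : ℝ) ^ 4 := by
    rw [← Real.exp_log (show (0 : ℝ) < (r : ℝ) ^ 6 / (n : ℝ) ^ 4 by positivity), hLdef,
      Real.log_div (by positivity) (by positivity), Real.log_div (by positivity) (by positivity),
      Real.log_pow, Real.log_pow, Real.log_pow]
    congr 1
    push_cast
    ring
  have hM := le_M0star n r m
  rw [← hLdef] at hM
  set M : ℝ := ((M0star n r m : ℕ) : ℝ) with hMdef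
  have hsimple : ∀ v, ((S.filter fun H =>
      3 / 4 * M ≤ ((compsAt (· = 1) v H).card : ℝ)).card : ℝ) ≤
      (r : ℝ) ^ 6 / (n : ℝ) ^ 4 * S.card := by
    intro v
    have hl2 := Real.log_two_gt_d9
    refine (htail (· = 1) v (m * r) (fun H hH => sum_comps_one_le ((hS H).mp hH).1)
      (7 * Real.log 2 + Real.log r) _ (by linarith)).trans ?_
    rw [← hexp]
    refine mul_le_mul_of_nonneg_right (Real.exp_le_exp.mpr ?_) (Nat.cast_nonneg _)
    have he : Real.exp (7 * Real.log 2 + Real.log r) = 128 * r := by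
      have h7 : 7 * Real.log 2 = Real.log 128 := by
        rw [show (128 : ℝ) = 2 ^ 7 by norm_num, Real.log_pow]
        norm_num
      rw [Real.exp_add, Real.exp_log hr0, h7, Real.exp_log (by norm_num)]
    rw [he]
    set z : ℝ := (r : ℝ) ^ 2 * m / n with hz
    have hz0 : 0 ≤ z := by positivity
    have h1 : 2 * ((m * r : ℕ) : ℝ) / n * (128 * r) = 256 * z := by
      rw [hz]; push_cast; ring
    have h2 : 81 * (r : ℝ) ^ 2 * (m : ℝ) / (n : ℝ) = 81 * z := by rw [hz]; ring
    rw [h2] at hM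
    rw [h1]
    set ρ := Real.log r
    have ht : 5.8 ≤ 7 * Real.log 2 + ρ := by linarith
    have h3 : (7 * Real.log 2 + ρ) * (3 / 4 * (L + 81 * z)) ≤
        (7 * Real.log 2 + ρ) * (3 / 4 * M) := by gcongr
    have h4 : 5.8 * z ≤ (7 * Real.log 2 + ρ) * z := by gcongr
    have h5 : (4.8 + ρ) * L ≤ (7 * Real.log 2 + ρ) * L := by
      apply mul_le_mul_of_nonneg_right <;> linarith
    nlinarith
  have hcluster : ∀ v, ((S.filter fun H =>
      1 / 12 * M ≤ ((compsAt (2 ≤ ·) v H).card : ℝ)).card : ℝ) ≤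
      3 * ((r : ℝ) ^ 6 / (n : ℝ) ^ 4) * S.card := by
    intro v
    refine (htail (2 ≤ ·) v (h * (3 * r)) (fun H hH => sum_comps_two_le ((hS H).mp hH))
      (48 + Real.log r) _ (by linarith)).trans ?_
    rw [← hexp]
    refine mul_le_mul_of_nonneg_right ?_ (Nat.cast_nonneg _)
    calc _ ≤ Real.exp (1 + -(4 * L + 2 * Real.log r)) := by
          refine Real.exp_le_exp.mpr ?_
          have he : Real.exp (48 + Real.log r) = Real.exp 48 * r := by
            rw [Real.exp_add, Real.exp_log hr0]
          have h1 : 2 * ((h * (3 * r) : ℕ) : ℝ) / n * (Real.exp 48 * r) =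
              6 * Real.exp 48 * (r : ℝ) ^ 2 * (h : ℝ) / n := by push_cast; ring
          rw [he, h1]
          have hLM : L ≤ M := le_trans (le_add_of_nonneg_right (by positivity)) hM
          set ρ := Real.log r
          have h3 : (48 + ρ) * (1 / 12 * L) ≤ (48 + ρ) * (1 / 12 * M) := by gcongr
          nlinarith
      _ ≤ 3 * Real.exp (-(4 * L + 2 * Real.log r)) := by
          rw [Real.exp_add]
          refine mul_le_mul_of_nonneg_right ?_ (Real.exp_pos _).le
          linarith [Real.exp_one_lt_d9]
  have hM0 : 0 ≤ M := Nat.cast_nonneg _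
  have hsub : (Cplus n r m h₁ h₂ h₃ h₄ \ Cplusplus n r m h₁ h₂ h₃ h₄) ⊆
      ((univ.biUnion fun v : Fin n =>
        (S.filter fun H => 3 / 4 * M ≤ ((compsAt (· = 1) v H).card : ℝ)) ∪
        (S.filter fun H => 1 / 12 * M ≤ ((compsAt (2 ≤ ·) v H).card : ℝ)) :
        Finset (Finset (Finset (Fin n)))) : Set (Finset (Finset (Fin n)))) := by
    rintro H ⟨hH, hH'⟩
    obtain ⟨v, hv⟩ := exists_lt_hdegree hH hH'
    have hd := hdegree_le_compsAt hH.1 v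
    have hd' : M ≤ ((compsAt (· = 1) v H).card : ℝ) + 3 * ((compsAt (2 ≤ ·) v H).card : ℝ) := by
      have := hv.le.trans hd
      rw [hMdef]
      exact_mod_cast this
    rw [mem_coe, mem_biUnion]
    refine ⟨v, mem_univ _, ?_⟩
    rw [mem_union, mem_filter, mem_filter, hS]
    by_cases h1 : 3 / 4 * M ≤ ((compsAt (· = 1) v H).card : ℝ)
    · exact .inl ⟨hH, h1⟩
    · exact .inr ⟨hH, by linarith⟩
  have hdiff : (((Cplus n r m h₁ h₂ h₃ h₄ \ Cplusplus n r m h₁ h₂ h₃ h₄).ncard : ℕ) : ℝ) ≤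
      4 * ((r : ℝ) ^ 6 / (n : ℝ) ^ 3) * S.card := by
    have h1 := Set.ncard_le_ncard hsub (Set.toFinite _)
    rw [Set.ncard_coe_finset] at h1
    have h2 := h1.trans card_biUnion_le
    have h3 : (((Cplus n r m h₁ h₂ h₃ h₄ \ Cplusplus n r m h₁ h₂ h₃ h₄).ncard : ℕ) : ℝ) ≤
        ∑ _v : Fin n, 4 * ((r : ℝ) ^ 6 / (n : ℝ) ^ 4) * S.card := by
      refine (Nat.cast_le.mpr h2).trans ?_
      rw [Nat.cast_sum]
      refine sum_le_sum fun v _ => ?_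
      refine (Nat.cast_le.mpr (card_union_le _ _)).trans ?_
      rw [Nat.cast_add]
      linarith [hsimple v, hcluster v]
    refine h3.trans_eq ?_
    rw [sum_const, card_univ, Fintype.card_fin, nsmul_eq_mul]
    field_simp
  have hsum := Set.ncard_sdiff_add_ncard_of_subset (Cplusplus_subset_Cplus n r m h₁ h₂ h₃ h₄)
    (Set.toFinite _)
  have hsum' : (((Cplus n r m h₁ h₂ h₃ h₄ \ Cplusplus n r m h₁ h₂ h₃ h₄).ncard : ℕ) : ℝ) +
      (Cplusplus n r m h₁ h₂ h₃ h₄).ncard = (Cplus n r m h₁ h₂ h₃ h₄).ncard := by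
    exact_mod_cast hsum
  rw [abs_sub_comm, abs_of_nonneg (by rw [← hsum']; simp), ← hsum', add_sub_cancel_right, hsum',
    hScard]
  exact hdiff

/-- The error terms are small when `m` is at least `n / r ^ 2` and at most a small multiple of
`n ^ (3 / 2) / r ^ 3`. -/
theorem parameter_bounds {n r m : ℕ} (hr : 3 ≤ r) (hn : 0 < n)
    (hlb : (n : ℝ) / (r : ℝ) ^ 2 ≤ m) {δ : ℝ} (hδ0 : 0 < δ) (hδ : δ ≤ 1)
    (hub : (m : ℝ) ≤ δ * ((n : ℝ) ^ ((3 : ℝ) / 2) / (r : ℝ) ^ 3)) :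
    -2 * Real.log δ ≤ Real.log ((n : ℝ) / (r : ℝ) ^ 2) ∧
    (r : ℝ) ^ 2 * ((M1 n r m + M2 n r m + M3 n r m + M4 n r m : ℕ) : ℝ) ≤ 176 * δ * n ∧
    (r : ℝ) ^ 2 * M0 n r m ≤ 87 * δ * n := by
  have hn' : (0 : ℝ) < n := Nat.cast_pos.mpr hn
  have hr' : (3 : ℝ) ≤ r := by exact_mod_cast hr
  have hr0 : (0 : ℝ) < r := by linarith
  obtain ⟨y, hy0, hy⟩ : ∃ y : ℝ, 0 < y ∧ (n : ℝ) = y ^ 2 :=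
    ⟨√n, Real.sqrt_pos.mpr hn', (Real.sq_sqrt hn'.le).symm⟩
  have hy3 : (n : ℝ) ^ ((3 : ℝ) / 2) = y ^ 3 := by
    rw [hy, ← Real.rpow_natCast, ← Real.rpow_mul hy0.le, ← Real.rpow_natCast]
    norm_num
  rw [hy3, ← mul_div_assoc, le_div_iff₀ (by positivity)] at hub
  rw [div_le_iff₀ (by positivity), hy] at hlb
  obtain ⟨q, hq0, hq⟩ : ∃ q : ℝ, 0 < q ∧ (r : ℝ) = q * y :=
    ⟨r / y, by positivity, by field_simp⟩
  have hqδ : q ≤ δ := by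
    have h1 : y ^ 2 * r ≤ δ * y ^ 3 := by nlinarith
    rw [hq] at h1
    refine le_of_mul_le_mul_left ?_ (show 0 < y ^ 3 by positivity)
    linarith
  obtain ⟨μ, hμ0, hμ⟩ : ∃ μ : ℝ, 0 ≤ μ ∧ (m : ℝ) = μ / q ^ 3 :=
    ⟨m * q ^ 3, by positivity, by field_simp⟩
  have hμδ : μ ≤ δ := by
    rw [hμ, hq] at hub
    have h1 : μ / q ^ 3 * (q * y) ^ 3 = μ * y ^ 3 := by field_simp
    rw [h1] at hub
    exact le_of_mul_le_mul_right hub (by positivity)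
  have hLq : (n : ℝ) / (r : ℝ) ^ 2 = (q ^ 2)⁻¹ := by rw [hy, hq]; field_simp
  have hL : Real.log ((n : ℝ) / (r : ℝ) ^ 2) = -2 * Real.log q := by
    rw [hLq, Real.log_inv, Real.log_pow]; push_cast; ring
  have hLδ : -2 * Real.log δ ≤ Real.log ((n : ℝ) / (r : ℝ) ^ 2) := by
    rw [hL]; linarith [Real.log_le_log hq0 hqδ]
  have hL0 : 0 ≤ Real.log ((n : ℝ) / (r : ℝ) ^ 2) :=
    le_trans (by linarith [Real.log_nonpos hδ0.le hδ]) hLδ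
  have hLb : q ^ 2 * Real.log ((n : ℝ) / (r : ℝ) ^ 2) ≤ 2 * q := by
    have h1 := Real.log_le_sub_one_of_pos (inv_pos.mpr hq0)
    rw [Real.log_inv] at h1
    have h2 : q * q⁻¹ = 1 := mul_inv_cancel₀ hq0.ne'
    rw [hL]
    nlinarith [mul_le_mul_of_nonneg_left h1 (sq_nonneg q)]
  set L := Real.log ((n : ℝ) / (r : ℝ) ^ 2) with hLdef
  have hrn : (r : ℝ) ^ 2 = q ^ 2 * n := by rw [hq, hy]; ring
  have hpow : ∀ a b : ℕ, (q : ℝ) ^ (a + 1) * μ ^ (b + 1) ≤ δ := fun a b => by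
    have h1 : q ^ (a + 1) ≤ 1 := pow_le_one₀ hq0.le (hqδ.trans hδ)
    have h2 : μ ^ (b + 1) ≤ δ := by
      rw [pow_succ]
      calc _ ≤ 1 * μ := mul_le_mul_of_nonneg_right (pow_le_one₀ hμ0 (hμδ.trans hδ)) hμ0
        _ ≤ δ := by linarith
    calc _ ≤ 1 * δ := mul_le_mul h1 h2 (by positivity) zero_le_one
      _ = δ := one_mul δ
  have hq2 : q ^ 2 ≤ δ := by nlinarith
  have hμ2 : μ ^ 2 ≤ δ := by nlinarith
  have e8 : q ^ 2 * ((r : ℝ) ^ 8 * (m : ℝ) ^ 3 / (n : ℝ) ^ 4) = q * μ ^ 3 := by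
    rw [hμ, hq, hy]; field_simp
  have e4 : q ^ 2 * ((r : ℝ) ^ 4 * (m : ℝ) ^ 2 / (n : ℝ) ^ 2) = μ ^ 2 := by
    rw [hμ, hq, hy]; field_simp
  have e2 : q ^ 2 * ((r : ℝ) ^ 2 * m / n) = q * μ := by
    rw [hμ, hq, hy]; field_simp
  have hmono : ∀ k ≤ 8, q ^ 2 * ((r : ℝ) ^ k * (m : ℝ) ^ 3 / (n : ℝ) ^ 4) ≤ δ := fun k hk => by
    have h1 := hpow 0 2
    have h2 : (r : ℝ) ^ k ≤ (r : ℝ) ^ 8 := pow_le_pow_right₀ (by linarith) hk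
    calc _ ≤ q ^ 2 * ((r : ℝ) ^ 8 * (m : ℝ) ^ 3 / (n : ℝ) ^ 4) := by gcongr
      _ = q ^ (0 + 1) * μ ^ (2 + 1) := by rw [e8]; ring
      _ ≤ δ := h1
  have hM123 : ∀ k ≤ 8, q ^ 2 * (⌈L + 81 * (r : ℝ) ^ k * (m : ℝ) ^ 3 / (2 * (n : ℝ) ^ 4)⌉₊ : ℝ) ≤
      44 * δ := fun k hk => by
    have h1 := (Nat.ceil_lt_add_one (show 0 ≤ L + 81 * (r : ℝ) ^ k * (m : ℝ) ^ 3 /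
      (2 * (n : ℝ) ^ 4) by positivity)).le
    have h2 := mul_le_mul_of_nonneg_left h1 (sq_nonneg q)
    have h3 : q ^ 2 * (L + 81 * (r : ℝ) ^ k * (m : ℝ) ^ 3 / (2 * (n : ℝ) ^ 4) + 1) =
      q ^ 2 * L + 81 / 2 * (q ^ 2 * ((r : ℝ) ^ k * (m : ℝ) ^ 3 / (n : ℝ) ^ 4)) + q ^ 2 := by
      field_simp
    linarith [hmono k hk]
  have hM4 : q ^ 2 * (M4 n r m : ℝ) ≤ 44 * δ := by
    have h1 := (Nat.ceil_lt_add_one (show 0 ≤ L + 81 * (r : ℝ) ^ 4 * (m : ℝ) ^ 2 /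
      (2 * (n : ℝ) ^ 2) by positivity)).le
    have h2 := mul_le_mul_of_nonneg_left h1 (sq_nonneg q)
    have h3 : q ^ 2 * (L + 81 * (r : ℝ) ^ 4 * (m : ℝ) ^ 2 / (2 * (n : ℝ) ^ 2) + 1) =
      q ^ 2 * L + 81 / 2 * (q ^ 2 * ((r : ℝ) ^ 4 * (m : ℝ) ^ 2 / (n : ℝ) ^ 2)) + q ^ 2 := by
      field_simp
    unfold M4
    linarith
  have hM0 : q ^ 2 * (M0 n r m : ℝ) ≤ 87 * δ := by
    have h1 := (Nat.ceil_lt_add_one (show 0 ≤ L + 81 * (r : ℝ) ^ 2 * (m : ℝ) / (n : ℝ) by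
      positivity)).le
    have h2 := mul_le_mul_of_nonneg_left h1 (sq_nonneg q)
    have h3 : q ^ 2 * (L + 81 * (r : ℝ) ^ 2 * (m : ℝ) / (n : ℝ) + 1) =
      q ^ 2 * L + 81 * (q ^ 2 * ((r : ℝ) ^ 2 * m / n)) + q ^ 2 := by
      ring
    have h4 := hpow 0 0
    simp only [zero_add, pow_one] at h4
    unfold M0 M0star
    push_cast
    linarith
  have h1 := hM123 8 le_rfl
  have h2 := hM123 7 (by norm_num)
  have h3 := hM123 6 (by norm_num)
  refine ⟨hLδ, ?_, ?_⟩
  · rw [hrn, mul_right_comm]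
    refine mul_le_mul_of_nonneg_right ?_ hn'.le
    push_cast
    unfold M1 M2 M3
    linarith
  · rw [hrn, mul_right_comm]
    exact mul_le_mul_of_nonneg_right hM0 hn'.le

/-- **Theorem 4.2**: for `r⁻²n ≤ m = o(r⁻³n^{3/2})`, uniformly over `0 ≤ hᵢ ≤ Mᵢ`,
`|C^{++}_{h₁,h₂,h₃,h₄}| = (1 - O(r⁶/n³)) |C^+_{h₁,h₂,h₃,h₄}|`. -/
theorem statement11 (r m : ℕ → ℕ) (hr : ∀ n, 3 ≤ r n)
    (hlb : ∀ᶠ n : ℕ in atTop, (n : ℝ) / (r n : ℝ) ^ 2 ≤ (m n : ℝ))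
    (hub : (fun n => (m n : ℝ)) =o[atTop]
      (fun n => (n : ℝ) ^ ((3 : ℝ) / 2) / (r n : ℝ) ^ 3)) :
    ∃ C > (0 : ℝ), ∃ n₀ : ℕ, ∀ n ≥ n₀, ∀ h₁ h₂ h₃ h₄ : ℕ,
      h₁ ≤ M1 n (r n) (m n) → h₂ ≤ M2 n (r n) (m n) →
      h₃ ≤ M3 n (r n) (m n) → h₄ ≤ M4 n (r n) (m n) →
      |((Cplusplus n (r n) (m n) h₁ h₂ h₃ h₄).ncard : ℝ)
          - ((Cplus n (r n) (m n) h₁ h₂ h₃ h₄).ncard : ℝ)|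
        ≤ C * ((r n : ℝ) ^ 6 / (n : ℝ) ^ 3)
          * ((Cplus n (r n) (m n) h₁ h₂ h₃ h₄).ncard : ℝ) := by
  obtain ⟨δ, hδ0, hδ⟩ : ∃ δ : ℝ, 0 < δ ∧ 4000 * Real.exp 48 * δ = 1 :=
    ⟨(4000 * Real.exp 48)⁻¹, by positivity, mul_inv_cancel₀ (by positivity)⟩
  have he1 : 1 ≤ Real.exp 48 := Real.one_le_exp (by norm_num)
  have hδ' : 4000 * δ ≤ 1 := by nlinarith
  have hδlog : Real.log δ ≤ -48 := by
    rw [Real.log_le_iff_le_exp hδ0, Real.exp_neg]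
    rw [le_inv_comm₀ hδ0 (Real.exp_pos _), ← one_div, le_div_iff₀ hδ0]
    nlinarith [mul_pos (Real.exp_pos 48) hδ0]
  obtain ⟨n₀, hn₀⟩ := eventually_atTop.mp
    ((hlb.and (hub.def hδ0)).and (eventually_gt_atTop 0))
  refine ⟨4, by norm_num, n₀, fun n hn h₁ h₂ h₃ h₄ b₁ b₂ b₃ b₄ => ?_⟩
  obtain ⟨⟨hlow, hup⟩, hnpos⟩ := hn₀ n hn
  have hr3 := hr n
  generalize r n = r at *
  generalize m n = m at *
  have hn' : (0 : ℝ) < n := Nat.cast_pos.mpr hnpos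
  have hr' : (3 : ℝ) ≤ r := by exact_mod_cast hr3
  have hr0 : (0 : ℝ) < r := by linarith
  have hm : 0 < m := by
    have : (0 : ℝ) < m := lt_of_lt_of_le (by positivity) hlow
    exact_mod_cast this
  rw [Real.norm_of_nonneg (by positivity), Real.norm_of_nonneg (by positivity)] at hup
  obtain ⟨c1, c2, c3⟩ := parameter_bounds hr3 hnpos hlow hδ0 (by linarith) hup
  have hh : (r : ℝ) ^ 2 * ((h₁ + h₂ + h₃ + h₄ : ℕ) : ℝ) ≤ 176 * δ * n := by
    refine le_trans (mul_le_mul_of_nonneg_left ?_ (by positivity)) c2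
    exact_mod_cast (by omega : h₁ + h₂ + h₃ + h₄ ≤ _)
  have hh0 : (0 : ℝ) ≤ ((h₁ + h₂ + h₃ + h₄ : ℕ) : ℝ) := Nat.cast_nonneg _
  refine ncard_diff_le hr3 hnpos hm (by linarith) ?_ ?_
  · have h1 : (r : ℝ) * ((h₁ + h₂ + h₃ + h₄ : ℕ) : ℝ) ≤
        (r : ℝ) ^ 2 * ((h₁ + h₂ + h₃ + h₄ : ℕ) : ℝ) :=
      mul_le_mul_of_nonneg_right (by nlinarith) hh0
    have h2 : 4000 * δ * n ≤ 1 * n := mul_le_mul_of_nonneg_right hδ' hn'.le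
    have h3 : 0 < δ * n := mul_pos hδ0 hn'
    linarith
  · rw [div_le_one hn']
    have h1 := mul_le_mul_of_nonneg_left hh (show 0 ≤ 6 * Real.exp 48 by positivity)
    have h2 : 6 * Real.exp 48 * (176 * δ * n) ≤ 4000 * Real.exp 48 * δ * n := by
      have : 0 < Real.exp 48 * δ * n := by positivity
      linarith
    rw [hδ, one_mul] at h2
    linarith
end
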